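/- arXiv:2404.05153 — 6 statements merged into one kernel-verified Lean document; each statement's English description precedes it below -/
import Mathlib

section
/- Let X be a simply connected length space and let D ∈ (0, 1) satisfy D + √(2 − 2√(1 − D²)) < 1. Then the Gromov–Hausdorff distance between X and the circle S¹ equipped with the Euclidean (chordal) metric inherited from ℝ² is at least D. (In particular, this Gromov–Hausdorff distance is at least the unique solution in (0,1) of D + √(2 − 2√(1 − D²)) = 1, approximately 0.49165.) -/
open Real Set Metric
open scoped ENNReal unitInterval

noncomputable section

/-- A *length space*: the distance between any two points equals the infimum of the
lengths (total variations) of continuous paths joining them. -/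
def IsLengthSpace (X : Type*) [MetricSpace X] : Prop :=
  ∀ x y : X,
    ENNReal.ofReal (dist x y) =
      ⨅ γ ∈ {γ : ℝ → X | ContinuousOn γ (Set.Icc 0 1) ∧ γ 0 = x ∧ γ 1 = y},
        eVariationOn γ (Set.Icc 0 1)

/-- A *geodesic space*: any two points are joined by a path whose length equals
their distance. -/
def IsGeodesicSpace (X : Type*) [MetricSpace X] : Prop :=
  ∀ x y : X, ∃ γ : ℝ → X, ContinuousOn γ (Set.Icc 0 1) ∧ γ 0 = x ∧ γ 1 = y ∧
    eVariationOn γ (Set.Icc 0 1) = ENNReal.ofReal (dist x y)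

/-- A continuous map `γ : [0,1] → Y` is a loop if its endpoints agree. -/
def IsLoop {Y : Type*} [TopologicalSpace Y] (γ : C(unitInterval, Y)) : Prop := γ 0 = γ 1

/-- Two loops are homotopic *through loops* (free homotopy of loops). -/
def LoopHomotopic {Y : Type*} [TopologicalSpace Y] (γ γ' : C(unitInterval, Y)) : Prop :=
  ∃ H : C(unitInterval × unitInterval, Y),
    (∀ t, H (0, t) = γ t) ∧ (∀ t, H (1, t) = γ' t) ∧ ∀ s, H (s, 0) = H (s, 1)

/-- A loop is nulhomotopic if it is homotopic, through loops, to a constant loop. -/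
def IsNullLoop {Y : Type*} [TopologicalSpace Y] (γ : C(unitInterval, Y)) : Prop :=
  ∃ y : Y, LoopHomotopic γ (ContinuousMap.const _ y)

/-- A correspondence between `X` and `Y`: a relation whose two projections are surjective. -/
def IsCorrespondence {X Y : Type*} (R : Set (X × Y)) : Prop :=
  (∀ x : X, ∃ y : Y, (x, y) ∈ R) ∧ (∀ y : Y, ∃ x : X, (x, y) ∈ R)

/-- The distortion of a relation `R ⊆ X × Y`,
`dis R = sup {|d_X(x,x') − d_Y(y,y')| : (x,y), (x',y') ∈ R}` (in `ℝ≥0∞`). -/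
noncomputable def distortion {X Y : Type*} [MetricSpace X] [MetricSpace Y]
    (R : Set (X × Y)) : ℝ≥0∞ :=
  ⨆ (p : R) (q : R),
    ENNReal.ofReal |dist (p : X × Y).1 (q : X × Y).1 - dist (p : X × Y).2 (q : X × Y).2|

/-- The Gromov–Hausdorff distance, expressed as half the infimal distortion of
correspondences between `X` and `Y` (valued in `ℝ≥0∞`). -/
noncomputable def ghDist (X Y : Type*) [MetricSpace X] [MetricSpace Y] : ℝ≥0∞ :=
  (⨅ R : {R : Set (X × Y) // IsCorrespondence R}, distortion (R : Set (X × Y))) / 2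

/-- The circle of circumference `2π`, i.e. `ℝ/2πℤ`, with its intrinsic (quotient) metric. -/
abbrev IntrinsicCircle := AddCircle (2 * π)

instance : Fact ((0:ℝ) < 2 * π) := ⟨by positivity⟩

/-- The lengths `π/2, π/2, π/4` of the three legs of the tripod `E`. -/
def tripodLeg : Fin 3 → ℝ := ![π/2, π/2, π/4]

/-- The tripod `E`: three segments of lengths `π/2`, `π/2`, `π/4` glued at a common
endpoint (the origin), realized as a union of coordinate segments in `ℝ³` with the
`ℓ¹`-metric; the induced metric is exactly the path metric of the tripod. -/
def TripodSet : Set (PiLp 1 fun _ : Fin 3 => ℝ) :=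
  {p | ∃ (i : Fin 3) (t : ℝ), 0 ≤ t ∧ t ≤ tripodLeg i ∧
    p = (WithLp.equiv 1 (∀ _ : Fin 3, ℝ)).symm (fun j => if j = i then t else 0)}

/-- The tripod `E` as a metric space. -/
abbrev TripodE : Type := ↥TripodSet

/-- An arc from `x` to `y`: a subspace homeomorphic to `[0,1]`, with endpoints `x` and `y`. -/
def IsArcBetween {X : Type*} [TopologicalSpace X] (x y : X) (A : Set X) : Prop :=
  ∃ γ : C(unitInterval, X), Function.Injective γ ∧ γ 0 = x ∧ γ 1 = y ∧ Set.range γ = A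

/-- An `ℝ`-tree: every pair of distinct points is joined by a unique arc, and this arc
is a geodesic segment (isometric to a real interval). -/
def IsRTree (X : Type*) [MetricSpace X] : Prop :=
  ∀ x y : X, x ≠ y →
    (∃! A : Set X, IsArcBetween x y A) ∧
    ∀ A : Set X, IsArcBetween x y A →
      ∃ γ : ℝ → X, γ 0 = x ∧ γ (dist x y) = y ∧
        γ '' Set.Icc 0 (dist x y) = A ∧
        ∀ s ∈ Set.Icc 0 (dist x y), ∀ t ∈ Set.Icc 0 (dist x y), dist (γ s) (γ t) = |s - t|

/-- The length of an `ℝ`-tree: the supremum of sums of lengths of pairwise disjoint arcs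
contained in it.  (In an `ℝ`-tree every arc is a geodesic segment, so its length is its
diameter.) -/
noncomputable def treeLength (X : Type*) [MetricSpace X] : ℝ≥0∞ :=
  ⨆ (S : Finset (Set X)) (_ : (∀ A ∈ S, ∃ x y : X, x ≠ y ∧ IsArcBetween x y A) ∧
      (S : Set (Set X)).Pairwise Disjoint), ∑ A ∈ S, EMetric.diam A

/-- The unit circle in `ℝ²` with the Euclidean (chordal) metric inherited from `ℝ²`. -/
abbrev EuclCircle : Type := ↥(Metric.sphere (0 : EuclideanSpace ℝ (Fin 2)) 1)

/-- In a length space, points at distance less than `r` are joined by a path each of whose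
points has distances to the two endpoints adding up to less than `r`. -/
theorem IsLengthSpace.exists_path {X : Type*} [MetricSpace X] (hX : IsLengthSpace X)
    {x y : X} {r : ℝ} (hr : dist x y < r) :
    ∃ γ : ℝ → X, ContinuousOn γ (Icc 0 1) ∧ γ 0 = x ∧ γ 1 = y ∧
      ∀ s ∈ Icc (0 : ℝ) 1, dist x (γ s) + dist (γ s) y < r := by
  have hr0 : 0 < r := dist_nonneg.trans_lt hr
  have h : ENNReal.ofReal (dist x y) < ENNReal.ofReal r :=
    (ENNReal.ofReal_lt_ofReal_iff hr0).2 hr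
  rw [hX x y] at h
  simp only [iInf_lt_iff] at h
  obtain ⟨γ, ⟨hγ, h0, h1⟩, hlt⟩ := h
  refine ⟨γ, hγ, h0, h1, fun s hs => ?_⟩
  have hsum := eVariationOn.Icc_add_Icc γ (s := Icc 0 1) hs.1 hs.2 hs
  rw [inter_self] at hsum
  have e0 : edist (γ 0) (γ s) ≤ eVariationOn γ (Icc 0 1 ∩ Icc 0 s) :=
    eVariationOn.edist_le γ ⟨by simp, by simp [hs.1]⟩ ⟨hs, by simp [hs.1]⟩
  have e1 : edist (γ s) (γ 1) ≤ eVariationOn γ (Icc 0 1 ∩ Icc s 1) :=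
    eVariationOn.edist_le γ ⟨hs, by simp [hs.2]⟩ ⟨by simp, by simp [hs.2]⟩
  have h2 := ((add_le_add e0 e1).trans_eq hsum).trans_lt hlt
  rw [h0, h1, edist_dist, edist_dist, ← ENNReal.ofReal_add dist_nonneg dist_nonneg] at h2
  exact (ENNReal.ofReal_lt_ofReal_iff hr0).1 h2

theorem IsLengthSpace.isPathConnected_ball {X : Type*} [MetricSpace X] (hX : IsLengthSpace X)
    (x : X) {r : ℝ} (hr : 0 < r) : IsPathConnected (ball x r) := by
  refine ⟨x, mem_ball_self hr, fun {y} hy => ?_⟩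
  obtain ⟨γ, hγ, h0, h1, h⟩ := hX.exists_path (mem_ball'.1 hy)
  refine JoinedIn.ofLine hγ h0 h1 ?_
  rintro _ ⟨s, hs, rfl⟩
  exact mem_ball'.2 ((le_add_of_nonneg_right dist_nonneg).trans_lt (h s hs))

theorem IsLengthSpace.locallyPathConnectedSpace {X : Type*} [MetricSpace X]
    (hX : IsLengthSpace X) : LocallyPathConnectedSpace X :=
  .of_bases (fun _ => nhds_basis_ball) fun x _ hr => hX.isPathConnected_ball x hr

section ConvexHull

variable {E : Type*} [NormedAddCommGroup E] [InnerProductSpace ℝ E]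

theorem lt_inner_of_mem_convexHull {S : Set E} {p w : E} {c : ℝ}
    (h : ∀ q ∈ S, c < inner ℝ p q) (hw : w ∈ convexHull ℝ S) : c < inner ℝ p w :=
  convexHull_min (t := {w | c < innerSL ℝ p w}) h
    (convex_halfSpace_gt (innerSL ℝ p).toLinearMap.isLinear c) hw

theorem lt_inner_of_dist_lt {p q : E} {r : ℝ} (hp : ‖p‖ = 1) (hq : ‖q‖ = 1)
    (h : dist q p < r) : 1 - r ^ 2 / 2 < inner ℝ p q := by
  have h1 := norm_sub_sq_real p q
  rw [dist_comm, dist_eq_norm] at h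
  have h2 : ‖p - q‖ ^ 2 < r ^ 2 := by gcongr
  rw [hp, hq] at h1
  linarith

variable {S : Set E} {p w : E}

theorem inner_pos_of_mem_convexHull (hS : ∀ q ∈ S, ‖q‖ = 1) (hp : ‖p‖ = 1)
    (h : ∀ q ∈ S, dist q p < 1) (hw : w ∈ convexHull ℝ S) : 0 < inner ℝ p w :=
  lt_inner_of_mem_convexHull
    (fun q hq => by linarith [lt_inner_of_dist_lt hp (hS q hq) (h q hq)]) hw

theorem ne_neg_smul_of_mem_convexHull (hS : ∀ q ∈ S, ‖q‖ = 1)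
    (hdiam : ∀ q ∈ S, ∀ q' ∈ S, dist q q' < 1) (hp : ‖p‖ = 1)
    (h : ∀ q ∈ S, dist q p < 3 / 2) (hw : w ∈ convexHull ℝ S) :
    w ≠ -(‖w‖ • p) := by
  intro hwp
  obtain ⟨q, hq⟩ : S.Nonempty := convexHull_nonempty_iff.1 ⟨w, hw⟩
  have h1 : 1 / 2 < inner ℝ q w := lt_inner_of_mem_convexHull
    (fun q' hq' => by
      linarith [lt_inner_of_dist_lt (hS q hq) (hS q' hq') (hdiam q' hq' q hq)]) hw
  have h2 : -1 / 8 < inner ℝ p w := lt_inner_of_mem_convexHull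
    (fun q hq => by linarith [lt_inner_of_dist_lt hp (hS q hq) (h q hq)]) hw
  have h3 : inner ℝ q w ≤ ‖w‖ := by simpa [hS q hq] using real_inner_le_norm q w
  have h4 : inner ℝ p w = -‖w‖ := by
    rw [hwp, inner_neg_right, real_inner_smul_right, real_inner_self_eq_norm_sq, hp, ← hwp]
    simp
  linarith

end ConvexHull

theorem Circle.dist_coe (p q : Circle) : dist (p : ℂ) q = dist p q := rfl

theorem Circle.dist_exp_le (a b : ℝ) : dist (Circle.exp a) (Circle.exp b) ≤ |a - b| := by
  have h : ((Circle.exp a : ℂ)) - Circle.exp b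
      = Circle.exp b * (Complex.exp (Complex.I * ((a - b : ℝ) : ℂ)) - 1) := by
    simp only [Circle.coe_exp, mul_sub, ← Complex.exp_add, mul_one]
    congr 2
    push_cast
    ring
  rw [← Circle.dist_coe, dist_eq_norm, h, norm_mul, Circle.norm_coe, one_mul]
  exact Real.norm_exp_I_mul_ofReal_sub_one_le

theorem Circle.inner_exp_exp (a b : ℝ) :
    inner ℝ (Circle.exp a : ℂ) (Circle.exp b : ℂ) = Real.cos (b - a) := by
  simp [Complex.inner, Complex.exp_re, Complex.exp_im, Real.cos_sub]

/-- A nowhere vanishing complex function on a simply connected, locally path connected space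
has a continuous argument, which may be taken to be principal at a given point. -/
theorem exists_continuous_arg {X : Type*} [TopologicalSpace X] [SimplyConnectedSpace X]
    [LocallyPathConnectedSpace X] (F : C(X, ℂ)) (hF : ∀ x, F x ≠ 0) (x₀ : X) :
    ∃ A : C(X, ℝ), A x₀ = (F x₀).arg ∧ ∀ x, F x = ‖F x‖ • (Circle.exp (A x) : ℂ) := by
  obtain ⟨G, ⟨hG₀, hG⟩, -⟩ := Complex.isCoveringMapOn_exp.existsUnique_continuousMap_lifts F
    (Complex.exp_log (hF x₀)) hF
  refine ⟨⟨fun x => (G x).im, by fun_prop⟩, by simp [hG₀, Complex.log_im], fun x => ?_⟩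
  have hx : Complex.exp (G x) = F x := congrFun hG x
  simp only [← hx, Complex.norm_exp, ContinuousMap.coe_mk, Circle.coe_exp, Complex.real_smul,
    Complex.ofReal_exp, ← Complex.exp_add, Complex.re_add_im]

section Winding

variable {X Z : Type*} [MetricSpace Z] {f : X → Z} {g : Circle → Z} {D : ℝ}

/-- The convex hull of the points of the circle whose images are `D`-close to the image
of `x`. -/
def nearbyHull (f : X → Z) (g : Circle → Z) (D : ℝ) (x : X) : Set ℂ :=
  convexHull ℝ ((↑) '' {q : Circle | dist (f x) (g q) < D})

theorem dist_lt_of_dist_apply_lt (hg : Isometry g) {x : X} {q p : Circle} {r : ℝ}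
    (hq : dist (f x) (g q) < D) (hp : dist (f x) (g p) ≤ r) : dist (q : ℂ) p < D + r := by
  rw [Circle.dist_coe, ← hg.dist_eq]
  linarith [dist_triangle_left (g q) (g p) (f x)]

theorem inner_pos_of_mem_nearbyHull (hg : Isometry g) (hD : D < 1 / 2) {x : X} {p : Circle}
    {w : ℂ} (hp : dist (f x) (g p) < D) (hw : w ∈ nearbyHull f g D x) :
    0 < inner ℝ (p : ℂ) w := by
  refine inner_pos_of_mem_convexHull ?_ (Circle.norm_coe p) ?_ hw
  · rintro _ ⟨q, -, rfl⟩
    exact Circle.norm_coe q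
  · rintro _ ⟨q, hq, rfl⟩
    linarith [dist_lt_of_dist_apply_lt hg hq hp.le]

theorem ne_neg_smul_of_mem_nearbyHull (hg : Isometry g) (hD : D < 1 / 2) {x : X} {p : Circle}
    {w : ℂ} (hp : dist (f x) (g p) ≤ 1) (hw : w ∈ nearbyHull f g D x) :
    w ≠ -(‖w‖ • (p : ℂ)) := by
  refine ne_neg_smul_of_mem_convexHull ?_ ?_ (Circle.norm_coe p) ?_ hw
  · rintro _ ⟨q, -, rfl⟩
    exact Circle.norm_coe q
  · rintro _ ⟨q, hq, rfl⟩ _ ⟨q', hq', rfl⟩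
    linarith [dist_lt_of_dist_apply_lt hg hq (le_of_lt hq')]
  · rintro _ ⟨q, hq, rfl⟩
    linarith [dist_lt_of_dist_apply_lt hg hq hp]

variable [MetricSpace X]

theorem exists_continuous_mem_nearbyHull (hf : Continuous f)
    (h : ∀ x, ∃ q, dist (f x) (g q) < D) : ∃ F : C(X, ℂ), ∀ x, F x ∈ nearbyHull f g D x := by
  refine exists_continuous_forall_mem_convex_of_local_const (fun x => convex_convexHull ℝ _)
    fun x => ?_
  obtain ⟨q, hq⟩ := h x
  refine ⟨q, ?_⟩
  filter_upwards [(hf.dist continuous_const).continuousAt.eventually_lt continuousAt_const hq]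
    with y hy using subset_convexHull ℝ _ ⟨q, hy, rfl⟩

/-- The angle `A` of a selection of `nearbyHull` stays on the branch of the angle of nearby
points of the circle. -/
theorem abs_arg_sub_lt_pi_div_two (hX : IsLengthSpace X) (hf : Isometry f) (hg : Isometry g)
    (hD : D < 1 / 2) {F : X → ℂ} (hF : ∀ x, F x ∈ nearbyHull f g D x) {A : X → ℝ}
    (hA : Continuous A) (hFA : ∀ x, F x = ‖F x‖ • (Circle.exp (A x) : ℂ)) {a b : ℝ}
    (hab : |a - b| < 1 / 2 - D) {x y : X} (hx : dist (f x) (g (Circle.exp a)) < D)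
    (hy : dist (f y) (g (Circle.exp b)) < D) (h : |A x - a| < π / 2) :
    |A y - b| < π / 2 := by
  have hgab : dist (g (Circle.exp a)) (g (Circle.exp b)) < 1 / 2 - D := by
    rw [hg.dist_eq]
    exact (Circle.dist_exp_le a b).trans_lt hab
  have hxy : dist x y < D + 1 / 2 := by
    rw [← hf.dist_eq]
    linarith [dist_triangle4 (f x) (g (Circle.exp a)) (g (Circle.exp b)) (f y),
      dist_comm (f y) (g (Circle.exp b))]
  have hD0 : 0 < D := dist_nonneg.trans_lt hx
  obtain ⟨γ, hγ, rfl, rfl, hγd⟩ := hX.exists_path hxy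
  have hnear : ∀ s ∈ Icc (0 : ℝ) 1, dist (f (γ s)) (g (Circle.exp a)) ≤ 1 := by
    intro s hs
    have h1 := hγd s hs
    rw [← hf.dist_eq, ← hf.dist_eq] at h1
    have h2 := dist_triangle_left (f (γ s)) (g (Circle.exp a)) (f (γ 0))
    have h3 := dist_triangle4 (f (γ s)) (f (γ 1)) (g (Circle.exp b)) (g (Circle.exp a))
    rw [dist_comm (g (Circle.exp b))] at h3
    by_contra! hcon
    linarith
  have hlt : |A (γ 1) - a| < π := by
    by_contra! hcon
    have hcont : ContinuousOn (fun s => |A (γ s) - a|) (Icc 0 1) := by fun_prop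
    obtain ⟨s, hs, hsπ⟩ := intermediate_value_Icc zero_le_one hcont
      ⟨by linarith [pi_pos], hcon⟩
    refine ne_neg_smul_of_mem_nearbyHull hg hD (hnear s hs) (hF (γ s)) ?_
    have hexp : Circle.exp (A (γ s)) = -(Circle.exp a : ℂ) := by
      rcases (abs_eq pi_pos.le).1 hsπ with h' | h'
      · rw [eq_add_of_sub_eq h', Circle.exp_add]
        simp
      · rw [eq_add_of_sub_eq h', Circle.exp_add]
        simp
    rw [← smul_neg, ← hexp]
    exact hFA _
  have hcos : 0 < Real.cos (A (γ 1) - b) := by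
    have h1 := inner_pos_of_mem_nearbyHull hg hD hy (hF (γ 1))
    rw [hFA, real_inner_smul_right, Circle.inner_exp_exp] at h1
    exact pos_of_mul_pos_right h1 (norm_nonneg _)
  have hb : |A (γ 1) - b| ≤ |A (γ 1) - a| + |a - b| := abs_sub_le _ _ _
  by_contra! hcon
  rw [← Real.cos_abs] at hcos
  exact hcos.not_ge (Real.cos_nonpos_of_pi_div_two_le_of_le hcon (by linarith [pi_gt_three]))

theorem exists_le_dist_circle [SimplyConnectedSpace X] (hX : IsLengthSpace X)
    (hf : Isometry f) (hg : Isometry g) (hD : D < 1 / 2)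
    (h : ∀ x, ∃ q, dist (f x) (g q) < D) : ∃ q, ∀ x, D ≤ dist (f x) (g q) := by
  by_contra! h'
  choose ξ hξ using h'
  have := hX.locallyPathConnectedSpace
  obtain ⟨F, hF⟩ := exists_continuous_mem_nearbyHull hf.continuous h
  have hF0 (x : X) : F x ≠ 0 := by
    obtain ⟨q, hq⟩ := h x
    have := inner_pos_of_mem_nearbyHull hg hD hq (hF x)
    rintro h0
    simp [h0] at this
  obtain ⟨A, hA₀, hA⟩ := exists_continuous_arg F hF0 (ξ 1)
  obtain ⟨n, hn⟩ := exists_nat_gt (2 * π / (1 / 2 - D))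
  have hn0 : (0 : ℝ) < n := (div_pos two_pi_pos (by linarith)).trans hn
  have hstart : |A (ξ 1)| < π / 2 := by
    rw [hA₀, Complex.abs_arg_lt_pi_div_two_iff]
    left
    simpa [Complex.inner] using inner_pos_of_mem_nearbyHull hg hD (hξ 1) (hF (ξ 1))
  have hind : ∀ j : ℕ, |A (ξ (Circle.exp (j * (2 * π / n)))) - j * (2 * π / n)| < π / 2 := by
    intro j
    induction j with
    | zero => simpa using hstart
    | succ j ih =>
      refine abs_arg_sub_lt_pi_div_two hX hf hg hD hF A.continuous hA ?_ (hξ _) (hξ _) ih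
      have hstep : (j : ℝ) * (2 * π / n) - (j + 1 : ℕ) * (2 * π / n) = -(2 * π / n) := by
        push_cast
        ring
      rw [hstep, abs_neg, abs_of_pos (div_pos two_pi_pos hn0)]
      exact (div_lt_comm₀ (by linarith) hn0).1 hn
  have hend := hind n
  rw [mul_div_cancel₀ _ hn0.ne', Circle.exp_two_pi] at hend
  rw [abs_lt] at hstart hend
  linarith [pi_pos]

end Winding

theorem lt_half_of_add_sqrt_lt_one {D : ℝ} (hD0 : 0 < D) (hD1 : D < 1)
    (h : D + √(2 - 2 * √(1 - D ^ 2)) < 1) : D < 1 / 2 := by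
  have h0 : √(1 - D ^ 2) ≤ 1 - D ^ 2 / 2 :=
    Real.sqrt_le_iff.2 ⟨by nlinarith, by nlinarith [sq_nonneg (D ^ 2)]⟩
  have h1 : D ≤ √(2 - 2 * √(1 - D ^ 2)) := Real.le_sqrt_of_sq_le (by linarith)
  linarith

/-- **Note 2.4.** If `X` is a simply connected length space and `D ∈ (0,1)` satisfies
`D + √(2 − 2√(1 − D²)) < 1`, then the Gromov–Hausdorff distance from `X` to the circle
with the chordal metric is `≥ D`: any isometric copies of `X` and `(S¹, d_{ℝ²})` in a
common metric space are at Hausdorff distance at least `D`. -/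
theorem ghDist_euclCircle_ge {X : Type*} [MetricSpace X]
    (hX : IsLengthSpace X) (hsc : SimplyConnectedSpace X)
    (D : ℝ) (hD0 : 0 < D) (hD1 : D < 1)
    (hcond : D + Real.sqrt (2 - 2 * Real.sqrt (1 - D ^ 2)) < 1)
    {Z : Type*} [MetricSpace Z] (f : X → Z) (g : EuclCircle → Z)
    (hf : Isometry f) (hg : Isometry g) :
    ENNReal.ofReal D ≤ EMetric.hausdorffEdist (Set.range f) (Set.range g) := by
  by_contra! hlt
  let e : ℂ ≃ₗᵢ[ℝ] EuclideanSpace ℝ (Fin 2) := Complex.orthonormalBasisOneI.repr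
  let c : Circle → EuclCircle := fun q => ⟨e q, by simp [Circle.norm_coe]⟩
  have hc : Isometry c := fun p q => e.isometry p q
  have hmem (p : EuclCircle) : e.symm p ∈ Submonoid.unitSphere ℂ :=
    mem_sphere_zero_iff_norm.2 (by simp)
  have hsurj (p : EuclCircle) : ∃ q, c q = p := ⟨⟨e.symm p, hmem p⟩, Subtype.ext (by simp [c])⟩
  obtain ⟨q, hq⟩ := exists_le_dist_circle hX hf (hg.comp hc)
    (lt_half_of_add_sqrt_lt_one hD0 hD1 hcond) (D := D) fun x => by
      obtain ⟨_, ⟨p, rfl⟩, hp⟩ := exists_edist_lt_of_hausdorffEDist_lt (mem_range_self x) hlt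
      obtain ⟨q, rfl⟩ := hsurj p
      exact ⟨q, edist_lt_ofReal.1 hp⟩
  obtain ⟨_, ⟨x, rfl⟩, hx⟩ := exists_edist_lt_of_hausdorffEDist_lt (mem_range_self (c q))
    (hausdorffEDist_comm.trans_lt hlt)
  rw [edist_lt_ofReal, dist_comm] at hx
  exact (hq x).not_gt hx

end
end

section
/- Let (X, d_X), (Y, d_Y) and (Z, d_Z) be nonempty metric spaces with diam(Z) ≤ 2·d_GH(X, Y). Equip the product X × Z with the metric d((x,z),(x',z')) = max(d_X(x,x'), d_Z(z,z')). Then d_GH(X × Z, Y) ≤ d_GH(X, Y). -/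
open Real Set Metric
open scoped ENNReal unitInterval

noncomputable section

theorem ofReal_abs_dist_sub_dist_le_distortion {X Y : Type*} [MetricSpace X] [MetricSpace Y]
    {R : Set (X × Y)} {p q : X × Y} (hp : p ∈ R) (hq : q ∈ R) :
    ENNReal.ofReal |dist p.1 q.1 - dist p.2 q.2| ≤ distortion R :=
  le_iSup₂_of_le (⟨p, hp⟩ : R) (⟨q, hq⟩ : R) le_rfl

theorem two_mul_ghDist_le_distortion {X Y : Type*} [MetricSpace X] [MetricSpace Y]
    {R : Set (X × Y)} (hR : IsCorrespondence R) : 2 * ghDist X Y ≤ distortion R := by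
  rw [ghDist, ENNReal.mul_div_cancel (by norm_num) (by norm_num)]
  exact iInf_le (fun R : {R : Set (X × Y) // IsCorrespondence R} => distortion R.1) ⟨R, hR⟩

/-- The relation between `X × Z` and `Y` that ignores the `Z`-coordinate. -/
def prodRelation {X Y : Type*} (Z : Type*) (R : Set (X × Y)) : Set ((X × Z) × Y) :=
  {p | (p.1.1, p.2) ∈ R}

theorem IsCorrespondence.prodRelation {X Y Z : Type*} [Nonempty Z] {R : Set (X × Y)}
    (hR : IsCorrespondence R) : IsCorrespondence (prodRelation Z R) := by
  refine ⟨fun p => hR.1 p.1, fun y => ?_⟩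
  obtain ⟨x, hx⟩ := hR.2 y
  exact ⟨(x, Classical.arbitrary Z), hx⟩

theorem distortion_prodRelation_le {X Y Z : Type*} [MetricSpace X] [MetricSpace Y]
    [MetricSpace Z] {R : Set (X × Y)}
    (hdiam : ediam (Set.univ : Set Z) ≤ distortion R) :
    distortion (prodRelation Z R) ≤ distortion R := by
  refine iSup₂_le ?_
  rintro ⟨⟨⟨x, z⟩, y⟩, hp⟩ ⟨⟨⟨x', z'⟩, y'⟩, hq⟩
  have hX := ofReal_abs_dist_sub_dist_le_distortion (R := R) hp hq
  have hZ : ENNReal.ofReal (dist z z') ≤ distortion R := by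
    rw [← edist_dist]
    exact (Metric.edist_le_ediam_of_mem (Set.mem_univ z) (Set.mem_univ z')).trans hdiam
  have hle : |max (dist x x') (dist z z') - dist y y'| ≤
      max |dist x x' - dist y y'| (dist z z') := by
    have h₁ := abs_le.1 (le_refl |dist x x' - dist y y'|)
    have h₂ : 0 ≤ dist y y' := dist_nonneg
    rcases le_total (dist x x') (dist z z') with h | h
    · rw [max_eq_right h, le_max_iff]
      rcases le_total (dist z z') (dist y y') with h' | h'
      · left; rw [abs_le]; constructor <;> linarith [abs_nonneg (dist x x' - dist y y')]
      · right; rw [abs_le]; constructor <;> linarith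
    · rw [max_eq_left h]
      exact le_max_left _ _
  calc ENNReal.ofReal |max (dist x x') (dist z z') - dist y y'|
      ≤ ENNReal.ofReal (max |dist x x' - dist y y'| (dist z z')) := ENNReal.ofReal_le_ofReal hle
    _ = max (ENNReal.ofReal |dist x x' - dist y y'|) (ENNReal.ofReal (dist z z')) :=
        ENNReal.ofReal_mono.map_max
    _ ≤ distortion R := max_le hX hZ

/-- **Proposition 4.1.** If `diam Z ≤ 2·d_GH(X, Y)`, then the product `X × Z` with the
`max` metric (which is the product metric in Mathlib) satisfies
`d_GH(X × Z, Y) ≤ d_GH(X, Y)`. -/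
theorem ghDist_prod_le {X Y Z : Type*} [MetricSpace X] [MetricSpace Y] [MetricSpace Z]
    [Nonempty X] [Nonempty Y] [Nonempty Z]
    (hdiam : EMetric.diam (Set.univ : Set Z) ≤ 2 * ghDist X Y) :
    ghDist (X × Z) Y ≤ ghDist X Y := by
  refine ENNReal.div_le_div_right (le_iInf fun R => ?_) 2
  exact iInf_le_of_le ⟨prodRelation Z R.1, R.2.prodRelation⟩
    (distortion_prodRelation_le (hdiam.trans (two_mul_ghDist_le_distortion R.2)))

end
end

section
/- Let (X, d_X) be a nonempty simply connected geodesic space with diam(X) ≤ π/2, and let E be the metric tripod obtained by gluing three segments of lengths π/2, π/2 and π/4 at a common endpoint. Equip X × E with the metric d((x,e),(x',e')) = max(d_X(x,x'), d_E(e,e')). Then X × E is a simply connected geodesic space and d_GH(X × E, S¹) = π/4. -/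
open Real Set Metric
open scoped ENNReal unitInterval

noncomputable section

/-! ### Geodesic spaces -/

/-- In a geodesic space any two points are joined by a path of constant speed. -/
theorem IsGeodesicSpace.exists_constant_speed {Y : Type*} [MetricSpace Y]
    (hY : IsGeodesicSpace Y) (x y : Y) :
    ∃ γ : ℝ → Y, γ 0 = x ∧ γ 1 = y ∧
      ∀ s ∈ Icc (0 : ℝ) 1, ∀ t ∈ Icc (0 : ℝ) 1, dist (γ s) (γ t) = dist x y * |s - t| := by
  obtain ⟨γ, hc, h0, h1, hv⟩ := hY x y
  have htri : ∀ s t : ℝ, 0 ≤ s → s ≤ t → t ≤ 1 →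
      dist x (γ s) + dist (γ s) (γ t) + dist (γ t) y ≤ dist x y := by
    intro s t hs hst ht
    have key : edist x (γ s) + edist (γ s) (γ t) + edist (γ t) y ≤
        ENNReal.ofReal (dist x y) := by
      have e₁ := eVariationOn.Icc_add_Icc γ (s := univ) hs hst (mem_univ _)
      have e₂ := eVariationOn.Icc_add_Icc γ (s := univ) (hs.trans hst) ht (mem_univ _)
      simp only [univ_inter] at e₁ e₂
      rw [← hv, ← e₂, ← e₁]
      nth_rewrite 1 [← h0]
      rw [← h1]
      gcongr
      · exact eVariationOn.edist_le γ (left_mem_Icc.2 hs) (right_mem_Icc.2 hs)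
      · exact eVariationOn.edist_le γ (left_mem_Icc.2 hst) (right_mem_Icc.2 hst)
      · exact eVariationOn.edist_le γ (left_mem_Icc.2 ht) (right_mem_Icc.2 ht)
    rw [edist_dist, edist_dist, edist_dist, ← ENNReal.ofReal_add dist_nonneg dist_nonneg,
      ← ENNReal.ofReal_add (by positivity) dist_nonneg] at key
    exact (ENNReal.ofReal_le_ofReal_iff dist_nonneg).1 key
  have hdist : ∀ s t : ℝ, 0 ≤ s → s ≤ t → t ≤ 1 →
      dist (γ s) (γ t) = dist x (γ t) - dist x (γ s) := by
    intro s t hs hst ht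
    have h₁ := htri s t hs hst ht
    have h₂ := dist_triangle x (γ t) y
    have h₃ := dist_triangle x (γ s) (γ t)
    linarith
  have hdist' : ∀ s ∈ Icc (0 : ℝ) 1, ∀ t ∈ Icc (0 : ℝ) 1,
      dist (γ s) (γ t) = |dist x (γ s) - dist x (γ t)| := by
    intro s hs t ht
    rcases le_total s t with h | h
    · have := hdist s t hs.1 h ht.2
      rw [abs_sub_comm, ← this, abs_of_nonneg dist_nonneg]
    · have := hdist t s ht.1 h hs.2
      rw [← this, abs_of_nonneg dist_nonneg, dist_comm]
  have hivt : ∀ u ∈ Icc (0 : ℝ) 1, ∃ t ∈ Icc (0 : ℝ) 1, dist x (γ t) = dist x y * u := by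
    intro u hu
    have hcont : ContinuousOn (fun t => dist x (γ t)) (Icc 0 1) :=
      (continuous_const.dist continuous_id).comp_continuousOn hc
    have := intermediate_value_Icc zero_le_one hcont
    simp only [h0, h1, dist_self] at this
    exact this ⟨mul_nonneg dist_nonneg hu.1, mul_le_of_le_one_right dist_nonneg hu.2⟩
  choose! τ hτ hτd using hivt
  have hd : ∀ s ∈ Icc (0 : ℝ) 1, ∀ t ∈ Icc (0 : ℝ) 1,
      dist (γ (τ s)) (γ (τ t)) = dist x y * |s - t| := by
    intro s hs t ht
    rw [hdist' _ (hτ s hs) _ (hτ t ht), hτd s hs, hτd t ht, ← mul_sub, abs_mul,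
      abs_of_nonneg dist_nonneg]
  have hx : γ (τ 0) = x := by
    have := hτd 0 (by simp)
    rw [mul_zero] at this
    exact (dist_eq_zero.1 this).symm
  have hy : γ (τ 1) = y := by
    have h₁ := hdist' _ (hτ 1 (by simp)) 1 (by simp)
    rw [hτd 1 (by simp), h1, mul_one, sub_self, abs_zero] at h₁
    exact dist_eq_zero.1 h₁
  exact ⟨γ ∘ τ, hx, hy, hd⟩

/-- A space in which any two points are joined by a path of constant speed is geodesic. -/
theorem IsGeodesicSpace.of_constant_speed {Y : Type*} [MetricSpace Y]
    (h : ∀ x y : Y, ∃ γ : ℝ → Y, γ 0 = x ∧ γ 1 = y ∧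
      ∀ s ∈ Icc (0 : ℝ) 1, ∀ t ∈ Icc (0 : ℝ) 1, dist (γ s) (γ t) = dist x y * |s - t|) :
    IsGeodesicSpace Y := by
  intro x y
  obtain ⟨γ, h0, h1, hd⟩ := h x y
  have hL : LipschitzOnWith (nndist x y) γ (Icc 0 1) :=
    LipschitzOnWith.of_dist_le_mul fun s hs t ht => by
      rw [hd s hs t ht, coe_nndist, Real.dist_eq]
  refine ⟨γ, hL.continuousOn, h0, h1, le_antisymm ?_ ?_⟩
  · have h₁ := hL.comp_eVariationOn_le (mapsTo_id (Icc (0 : ℝ) 1))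
    have h₂ := (monotone_id.monotoneOn univ).eVariationOn_eq (mem_univ (0 : ℝ)) (mem_univ 1)
    simp only [univ_inter, id, sub_zero, ENNReal.ofReal_one] at h₂
    calc eVariationOn γ (Icc 0 1) ≤ nndist x y * eVariationOn id (Icc (0 : ℝ) 1) := h₁
      _ = ENNReal.ofReal (dist x y) := by rw [h₂, mul_one, ← edist_nndist, edist_dist]
  · rw [← edist_dist]
    nth_rewrite 1 [← h0]
    rw [← h1]
    exact eVariationOn.edist_le γ (by simp) (by simp)

/-- A product of geodesic spaces, with the maximum metric, is geodesic. -/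
theorem IsGeodesicSpace.prod {Y Z : Type*} [MetricSpace Y] [MetricSpace Z]
    (hY : IsGeodesicSpace Y) (hZ : IsGeodesicSpace Z) : IsGeodesicSpace (Y × Z) := by
  refine .of_constant_speed fun p q => ?_
  obtain ⟨γ, h0, h1, hd⟩ := hY.exists_constant_speed p.1 q.1
  obtain ⟨η, k0, k1, kd⟩ := hZ.exists_constant_speed p.2 q.2
  refine ⟨fun t => (γ t, η t), by simp [h0, k0], by simp [h1, k1], fun s hs t ht => ?_⟩
  rw [Prod.dist_eq, Prod.dist_eq, hd s hs t ht, kd s hs t ht,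
    max_mul_of_nonneg _ _ (abs_nonneg _)]

/-! ### Simple connectedness -/

theorem SimplyConnectedSpace.prod {Y Z : Type*} [TopologicalSpace Y] [TopologicalSpace Z]
    [SimplyConnectedSpace Y] [SimplyConnectedSpace Z] : SimplyConnectedSpace (Y × Z) := by
  rw [simply_connected_iff_unique_homotopic]
  refine ⟨inferInstance, fun ⟨y, z⟩ ⟨y', z'⟩ => ⟨⟨⟨?_⟩, fun p => ?_⟩⟩⟩
  · exact Path.Homotopic.prod (Path.Homotopic.Quotient.mk (PathConnectedSpace.somePath y y'))
      (Path.Homotopic.Quotient.mk (PathConnectedSpace.somePath z z'))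
  · rw [← Path.Homotopic.prod_projLeft_projRight p]
    congr 1 <;> exact Subsingleton.elim _ _

/-! ### The tripod -/

theorem tripodLeg_nonneg (i : Fin 3) : 0 ≤ tripodLeg i := by
  have := pi_pos
  fin_cases i <;> simp [tripodLeg] <;> positivity

theorem tripodLeg_le (i : Fin 3) : tripodLeg i ≤ π / 2 := by
  have := pi_pos
  fin_cases i <;> simp [tripodLeg]; linarith

/-- The point at distance `t` from the centre on the `i`-th leg of the tripod. -/
def tripodPoint (i : Fin 3) (t : ℝ) (ht : t ∈ Icc 0 (tripodLeg i)) : TripodE :=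
  ⟨(WithLp.equiv 1 (∀ _ : Fin 3, ℝ)).symm (fun j => if j = i then t else 0),
    i, t, ht.1, ht.2, rfl⟩

theorem exists_eq_tripodPoint (e : TripodE) : ∃ i t ht, e = tripodPoint i t ht := by
  obtain ⟨e, i, t, h0, h1, rfl⟩ := e
  exact ⟨i, t, ⟨h0, h1⟩, rfl⟩

@[simp]
theorem tripodPoint_apply (i j : Fin 3) (t : ℝ) (ht) :
    (tripodPoint i t ht).1 j = if j = i then t else 0 := rfl

theorem TripodE.dist_eq (e e' : TripodE) :
    dist e e' = |e.1 0 - e'.1 0| + |e.1 1 - e'.1 1| + |e.1 2 - e'.1 2| := by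
  rw [Subtype.dist_eq, PiLp.dist_eq_of_L1, Fin.sum_univ_three]
  simp only [Real.dist_eq]

theorem dist_tripodPoint (i j : Fin 3) (s t : ℝ) (hs ht) :
    dist (tripodPoint i s hs) (tripodPoint j t ht) = if i = j then |s - t| else s + t := by
  have h₁ := abs_of_nonneg hs.1
  have h₂ := abs_of_nonneg ht.1
  rw [TripodE.dist_eq]
  fin_cases i <;> fin_cases j <;> simp [h₁, h₂, add_comm]

theorem isGeodesicSpace_tripodE : IsGeodesicSpace TripodE := by
  refine .of_constant_speed fun e e' => ?_
  obtain ⟨i, a, ha, rfl⟩ := exists_eq_tripodPoint e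
  obtain ⟨j, b, hb, rfl⟩ := exists_eq_tripodPoint e'
  have hclamp : ∀ k (t : ℝ), max 0 (min t (tripodLeg k)) ∈ Icc 0 (tripodLeg k) := fun k t =>
    ⟨le_max_left _ _, max_le (tripodLeg_nonneg k) (min_le_right _ _)⟩
  let ray (k : Fin 3) (t : ℝ) : TripodE := tripodPoint k _ (hclamp k t)
  have hray : ∀ k t ht, ray k t = tripodPoint k t ht := by
    intro k t ht
    have : max 0 (min t (tripodLeg k)) = t := by rw [min_eq_left ht.2, max_eq_right ht.1]
    simp only [ray, this]
  rw [dist_tripodPoint]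
  by_cases hij : i = j
  · subst hij
    rw [if_pos rfl]
    refine ⟨fun s => ray i (a + s * (b - a)), ?_, ?_, fun s hs t ht => ?_⟩
    · simp [hray i a ha]
    · simp [hray i b hb]
    · have hmem : ∀ s ∈ Icc (0 : ℝ) 1, a + s * (b - a) ∈ Icc 0 (tripodLeg i) := fun s hs =>
        (convex_Icc 0 (tripodLeg i)).add_smul_sub_mem ha hb hs
      beta_reduce
      rw [hray _ _ (hmem s hs), hray _ _ (hmem t ht), dist_tripodPoint, if_pos rfl, ← abs_mul,
        ← abs_neg]
      congr 1
      ring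
  · rw [if_neg hij]
    have ha0 := ha.1
    have hb0 := hb.1
    refine ⟨fun s => if s * (a + b) ≤ a then ray i (a - s * (a + b))
      else ray j (s * (a + b) - a), ?_, ?_, fun s hs t ht => ?_⟩
    · simp [ha0, hray i a ha]
    · simp only [one_mul, add_sub_cancel_left, hray j b hb]
      split_ifs with h
      · have hb' : b = 0 := by linarith
        have h' : a - (a + b) = 0 := by linarith
        rw [h', hray i 0 (left_mem_Icc.2 (tripodLeg_nonneg i)), ← dist_eq_zero, dist_tripodPoint,
          if_neg hij, hb', add_zero]
      · rfl
    · have hi : ∀ s ∈ Icc (0 : ℝ) 1, s * (a + b) ≤ a →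
          a - s * (a + b) ∈ Icc 0 (tripodLeg i) := fun s hs h =>
        ⟨by linarith, by nlinarith [ha.2, mul_nonneg hs.1 (add_nonneg ha0 hb0)]⟩
      have hj : ∀ s ∈ Icc (0 : ℝ) 1, ¬ s * (a + b) ≤ a →
          s * (a + b) - a ∈ Icc 0 (tripodLeg j) := fun s hs h =>
        ⟨by linarith, by nlinarith [hb.2, mul_le_of_le_one_left (add_nonneg ha0 hb0) hs.2]⟩
      have hR : (a + b) * |s - t| = |s * (a + b) - t * (a + b)| := by
        rw [← sub_mul, abs_mul, abs_of_nonneg (add_nonneg ha0 hb0), mul_comm]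
      rw [hR]
      by_cases h₁ : s * (a + b) ≤ a <;> by_cases h₂ : t * (a + b) ≤ a
      · simp only [h₁, h₂, if_true]
        rw [hray _ _ (hi s hs h₁), hray _ _ (hi t ht h₂), dist_tripodPoint, if_pos rfl, ← abs_neg]
        congr 1
        ring
      · simp only [h₁, h₂, if_true, if_false]
        rw [hray _ _ (hi s hs h₁), hray _ _ (hj t ht h₂), dist_tripodPoint, if_neg hij,
          abs_of_nonpos (by linarith)]
        ring
      · simp only [h₁, h₂, if_true, if_false]
        rw [hray _ _ (hj s hs h₁), hray _ _ (hi t ht h₂), dist_tripodPoint, if_neg (Ne.symm hij),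
          abs_of_nonneg (by linarith)]
        ring
      · simp only [h₁, h₂, if_false]
        rw [hray _ _ (hj s hs h₁), hray _ _ (hj t ht h₂), dist_tripodPoint, if_pos rfl]
        congr 1
        ring

theorem starConvex_tripodSet : StarConvex ℝ 0 TripodSet := by
  rintro _ ⟨i, t, h0, h1, rfl⟩ a b ha hb hab
  refine ⟨i, b * t, mul_nonneg hb h0, ?_, ?_⟩
  · exact (mul_le_of_le_one_left h0 (by linarith)).trans h1
  · ext j
    simp

instance : ContractibleSpace TripodE :=
  starConvex_tripodSet.contractibleSpace ⟨_, 0, 0, le_rfl, tripodLeg_nonneg 0, rfl⟩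

/-- The signed position on the segment formed by the two long legs, with the short leg
collapsed to the centre. -/
def tripodHeight (e : TripodE) : ℝ := e.1 0 - e.1 1

/-- Two points of the tripod that are less than `π/2` apart cannot exchange sides with
two such points, if both pairs of corresponding points are more than `π/2` apart. -/
theorem false_of_tripodHeight {a a' b b' : TripodE}
    (haa : π / 2 < dist a a') (hbb : π / 2 < dist b b')
    (hab : dist a b < π / 2) (hab' : dist a' b' < π / 2)
    (ha : tripodHeight a' ≤ tripodHeight a) (hb : tripodHeight b ≤ tripodHeight b') : False := by
  have hleg2 : ∀ t, t ∈ Icc 0 (tripodLeg 2) → t ≤ π / 4 := fun t ht => ht.2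
  obtain ⟨i, s, hs, rfl⟩ := exists_eq_tripodPoint a
  obtain ⟨i', s', hs', rfl⟩ := exists_eq_tripodPoint a'
  obtain ⟨j, t, ht, rfl⟩ := exists_eq_tripodPoint b
  obtain ⟨j', t', ht', rfl⟩ := exists_eq_tripodPoint b'
  have bs := hs.2.trans (tripodLeg_le _)
  have bs' := hs'.2.trans (tripodLeg_le _)
  have bt := ht.2.trans (tripodLeg_le _)
  have bt' := ht'.2.trans (tripodLeg_le _)
  have ps := hs.1
  have ps' := hs'.1
  have pt := ht.1
  have pt' := ht'.1
  rw [dist_tripodPoint] at haa hbb hab hab'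
  have hii : i ≠ i' := by
    rintro rfl
    rw [if_pos rfl, lt_abs] at haa
    rcases haa with h | h <;> linarith
  have hjj : j ≠ j' := by
    rintro rfl
    rw [if_pos rfl, lt_abs] at hbb
    rcases hbb with h | h <;> linarith
  rw [if_neg hii] at haa
  rw [if_neg hjj] at hbb
  have hsame : i = j ∨ i' = j' := by
    by_contra! h
    rw [if_neg h.1] at hab
    rw [if_neg h.2] at hab'
    linarith
  simp only [tripodHeight, tripodPoint_apply] at ha hb
  have h2s := hleg2 s
  have h2s' := hleg2 s'
  have h2t := hleg2 t
  have h2t' := hleg2 t'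
  clear hleg2
  fin_cases i <;> fin_cases i' <;> simp at hii <;> fin_cases j <;> fin_cases j' <;>
    simp at hjj hsame <;> simp at ha hb hab hab' hs hs' ht ht' h2s h2s' h2t h2t' <;> grind

/-! ### The circle -/

theorem IntrinsicCircle.dist_coe {a b : ℝ} (h : |a - b| ≤ π) :
    dist (a : IntrinsicCircle) (b : IntrinsicCircle) = |a - b| := by
  rw [dist_eq_norm, ← AddCircle.coe_sub, AddCircle.norm_coe_eq_abs_iff _ two_pi_pos.ne',
    abs_of_pos two_pi_pos]
  linarith

theorem IntrinsicCircle.dist_coe_of_ge {a b : ℝ} (h : π ≤ a - b) (h' : a - b ≤ 3 * π) :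
    dist (a : IntrinsicCircle) (b : IntrinsicCircle) = |2 * π - (a - b)| := by
  have : (b : IntrinsicCircle) = ((b + 2 * π : ℝ) : IntrinsicCircle) := by simp
  rw [this, dist_coe (by rw [abs_le]; constructor <;> linarith), ← abs_neg]
  congr 1
  ring

/-! ### The lower bound -/

theorem exists_sign_change {w : ℕ → ℝ} {n : ℕ} (hn : 0 < n) (h0 : 0 ≤ w 0) (h1 : w n ≤ 0) :
    ∃ i, 0 ≤ w i ∧ w (i + 1) ≤ 0 := by
  by_contra! h
  have : ∀ k, 0 ≤ w k := fun k => by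
    induction k with
    | zero => exact h0
    | succ k ih => exact (h k ih).le
  obtain ⟨m, rfl⟩ : ∃ m, n = m + 1 := ⟨n - 1, by omega⟩
  exact absurd h1 (not_le.2 (h m (this m)))

/-- A function from the circle to the tripod cannot both separate antipodal points by more than
`π/2` and send close points to points less than `π/2` apart. -/
theorem false_of_circle_to_tripod (f : IntrinsicCircle → TripodE) {ε : ℝ} (hε : 0 < ε)
    (hanti : ∀ p q, dist p q = π → π / 2 < dist (f p) (f q))
    (hnear : ∀ p q, dist p q < ε → dist (f p) (f q) < π / 2) : False := by
  obtain ⟨n, hn⟩ := exists_nat_gt (π / ε)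
  have hn0 : (0 : ℝ) < n := (by positivity : (0 : ℝ) < π / ε).trans hn
  have hstep : π / n < ε := by
    rw [div_lt_iff₀ hε] at hn
    rw [div_lt_iff₀ hn0]
    linarith
  have hstep1 : π / n ≤ π := div_le_self pi_pos.le (by exact_mod_cast hn0)
  let p (k : ℕ) : IntrinsicCircle := ((k * (π / n) : ℝ) : IntrinsicCircle)
  have hp_anti : ∀ k, dist (p k) (p (k + n)) = π := by
    intro k
    have : |(k * (π / n) : ℝ) - ((k + n : ℕ) : ℝ) * (π / n)| = π := by
      rw [abs_sub_comm, ← sub_mul]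
      push_cast
      rw [add_sub_cancel_left, mul_div_cancel₀ _ hn0.ne', abs_of_pos pi_pos]
    rw [IntrinsicCircle.dist_coe this.le, this]
  have hp_near : ∀ k, dist (p k) (p (k + 1)) < ε := by
    intro k
    have : |(k * (π / n) : ℝ) - ((k + 1 : ℕ) : ℝ) * (π / n)| = π / n := by
      rw [abs_sub_comm, ← sub_mul]
      push_cast
      rw [add_sub_cancel_left, one_mul, abs_of_pos (by positivity)]
    rw [IntrinsicCircle.dist_coe (this.trans_le hstep1), this]
    exact hstep
  have hp_period : p (n + n) = p 0 := by
    have : ((n + n : ℕ) : ℝ) * (π / n) = 2 * π := by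
      push_cast
      field_simp
      ring
    simp only [p, this]
    simp
  let w (k : ℕ) : ℝ := tripodHeight (f (p k)) - tripodHeight (f (p (k + n)))
  have hw : w n = -w 0 := by
    simp only [w, hp_period, zero_add]
    ring
  have hn' : 0 < n := by exact_mod_cast hn0
  have hp_near' : ∀ k, dist (p (k + n)) (p (k + 1 + n)) < ε := fun k => by
    rw [add_right_comm]
    exact hp_near (k + n)
  rcases le_total 0 (w 0) with h0 | h0
  · obtain ⟨k, hk, hk'⟩ := exists_sign_change hn' h0 (by linarith)
    exact false_of_tripodHeight (hanti _ _ (hp_anti k)) (hanti _ _ (hp_anti (k + 1)))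
      (hnear _ _ (hp_near k)) (hnear _ _ (hp_near' k)) (sub_nonneg.1 hk) (sub_nonpos.1 hk')
  · obtain ⟨k, hk, hk'⟩ := exists_sign_change (w := fun k => -w k) hn' (by linarith) (by linarith)
    refine false_of_tripodHeight ?_ ?_ (hnear _ _ (hp_near' k)) (hnear _ _ (hp_near k))
      (sub_nonpos.1 (neg_nonneg.1 hk)) (sub_nonneg.1 (neg_nonpos.1 hk'))
    · rw [dist_comm]
      exact hanti _ _ (hp_anti k)
    · rw [dist_comm]
      exact hanti _ _ (hp_anti (k + 1))

theorem le_distortion_of_isCorrespondence {X : Type*} [MetricSpace X]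
    (hdiam : ∀ x y : X, dist x y ≤ π / 2) {R : Set ((X × TripodE) × IntrinsicCircle)}
    (hR : IsCorrespondence R) : ENNReal.ofReal (π / 2) ≤ distortion R := by
  by_contra! hlt
  obtain ⟨δ, hδ0, hδ, hδπ⟩ : ∃ δ : ℝ, 0 ≤ δ ∧ distortion R = ENNReal.ofReal δ ∧ δ < π / 2 := by
    refine ⟨(distortion R).toReal, ENNReal.toReal_nonneg, (ENNReal.ofReal_toReal hlt.ne_top).symm,
      ?_⟩
    exact (ENNReal.lt_ofReal_iff_toReal_lt hlt.ne_top).1 hlt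
  choose g hg using hR.2
  have hdis : ∀ p q, |dist (g p) (g q) - dist p q| ≤ δ := by
    intro p q
    have : ENNReal.ofReal |dist (g p) (g q) - dist p q| ≤ distortion R :=
      le_iSup₂_of_le (⟨_, hg p⟩ : R) (⟨_, hg q⟩ : R) le_rfl
    rwa [hδ, ENNReal.ofReal_le_ofReal_iff hδ0] at this
  refine false_of_circle_to_tripod (fun p => (g p).2) (sub_pos.2 hδπ) (fun p q hpq => ?_)
    fun p q hpq => ?_
  · have h := (abs_le.1 (hdis p q)).1
    have h' : π / 2 < dist (g p) (g q) := by linarith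
    rw [Prod.dist_eq, lt_max_iff] at h'
    exact h'.resolve_left (not_lt.2 (hdiam _ _))
  · have h := (abs_le.1 (hdis p q)).2
    have h' : dist (g p).2 (g q).2 ≤ dist (g p) (g q) := le_max_right _ _
    linarith

/-! ### The upper bound -/

/-- The position on a long leg of the tripod that corresponds to the angle `θ ∈ [0, π]`. -/
def longLegPosition (θ : ℝ) : ℝ := max 0 (min (π / 4 + θ) (3 * π / 4 - θ))

/-- The position on the short leg of the tripod that corresponds to the angle `θ ∈ [0, π]`. -/
def shortLegPosition (θ : ℝ) : ℝ := max 0 (θ - 3 * π / 4)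

theorem abs_same_side_le {θ φ : ℝ} (hθ : θ ∈ Icc 0 π) (hφ : φ ∈ Icc 0 π) :
    |(|longLegPosition θ - longLegPosition φ| + |shortLegPosition θ - shortLegPosition φ|) -
      (|θ - φ|)| ≤ π / 2 := by
  obtain ⟨h0, h1⟩ := hθ
  obtain ⟨k0, k1⟩ := hφ
  unfold longLegPosition shortLegPosition
  have := pi_pos
  generalize π = P at *
  grind

theorem abs_opposite_side_le {θ φ s : ℝ} (hθ : θ ∈ Icc 0 π) (hφ : φ ∈ Icc 0 π)
    (hs : s = min (θ + φ) (2 * π - (θ + φ))) :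
    |(longLegPosition θ + longLegPosition φ + |shortLegPosition θ - shortLegPosition φ|) - s|
      ≤ π / 2 := by
  obtain ⟨h0, h1⟩ := hθ
  obtain ⟨k0, k1⟩ := hφ
  unfold longLegPosition shortLegPosition
  have := pi_pos
  generalize π = P at *
  grind

theorem longLegPosition_nonneg (θ : ℝ) : 0 ≤ longLegPosition θ := le_max_left _ _

theorem dist_coe_neg_coe {θ φ : ℝ} (hθ : θ ∈ Icc 0 π) (hφ : φ ∈ Icc 0 π) :
    dist (θ : IntrinsicCircle) ((-φ : ℝ) : IntrinsicCircle) =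
      min (θ + φ) (2 * π - (θ + φ)) := by
  obtain ⟨h0, h1⟩ := hθ
  obtain ⟨k0, k1⟩ := hφ
  rcases le_total (θ + φ) π with h | h
  · rw [IntrinsicCircle.dist_coe, min_eq_left, sub_neg_eq_add, abs_of_nonneg] <;>
      try linarith
    rw [sub_neg_eq_add, abs_of_nonneg] <;> linarith
  · rw [IntrinsicCircle.dist_coe_of_ge, min_eq_right, sub_neg_eq_add, abs_of_nonneg] <;>
      linarith

/-- The correspondence between the tripod and the circle: the two halves of the circle run from the
midpoint of one long leg to its tip, back to the centre, and on to the tip of the short leg. -/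
def tripodCircleRel (e : TripodE) (p : IntrinsicCircle) : Prop :=
  ∃ θ ∈ Icc 0 π, e.1 2 = shortLegPosition θ ∧
    (p = (θ : IntrinsicCircle) ∧ e.1 0 = longLegPosition θ ∧ e.1 1 = 0 ∨
      p = ((-θ : ℝ) : IntrinsicCircle) ∧ e.1 0 = 0 ∧ e.1 1 = longLegPosition θ)

theorem abs_dist_sub_dist_le_of_tripodCircleRel {e e' : TripodE} {p p' : IntrinsicCircle}
    (h : tripodCircleRel e p) (h' : tripodCircleRel e' p') :
    |dist e e' - dist p p'| ≤ π / 2 := by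
  obtain ⟨θ, hθ, h₂, h⟩ := h
  obtain ⟨φ, hφ, h₂', h'⟩ := h'
  have habs : |θ - φ| ≤ π := by
    rw [abs_le]
    constructor <;> linarith [hθ.1, hθ.2, hφ.1, hφ.2]
  have pθ := abs_of_nonneg (longLegPosition_nonneg θ)
  have pφ := abs_of_nonneg (longLegPosition_nonneg φ)
  rw [TripodE.dist_eq, h₂, h₂']
  rcases h with ⟨rfl, h₀, h₁⟩ | ⟨rfl, h₀, h₁⟩ <;> rcases h' with ⟨rfl, h₀', h₁'⟩ | ⟨rfl, h₀', h₁'⟩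
  · rw [h₀, h₁, h₀', h₁', IntrinsicCircle.dist_coe habs]
    simpa using abs_same_side_le hθ hφ
  · rw [h₀, h₁, h₀', h₁', sub_zero, zero_sub, abs_neg, pθ, pφ]
    exact abs_opposite_side_le hθ hφ (dist_coe_neg_coe hθ hφ)
  · rw [h₀, h₁, h₀', h₁', sub_zero, zero_sub, abs_neg, pθ, pφ, dist_comm,
      add_comm (longLegPosition φ)]
    exact abs_opposite_side_le hθ hφ ((dist_coe_neg_coe hφ hθ).trans (by rw [add_comm φ]))
  · rw [h₀, h₁, h₀', h₁', AddCircle.coe_neg, AddCircle.coe_neg, dist_neg_neg,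
      IntrinsicCircle.dist_coe habs]
    simpa using abs_same_side_le hθ hφ

theorem exists_tripodCircleRel_left (e : TripodE) : ∃ p, tripodCircleRel e p := by
  have hπ := pi_pos
  obtain ⟨i, t, ⟨h0, h1⟩, rfl⟩ := exists_eq_tripodPoint e
  have hlong : t ≤ π / 2 → 3 * π / 4 - t ∈ Icc 0 π ∧ 0 = shortLegPosition (3 * π / 4 - t) ∧
      t = longLegPosition (3 * π / 4 - t) := by
    intro h
    refine ⟨⟨by linarith, by linarith⟩, ?_, ?_⟩
    · rw [shortLegPosition, max_eq_left (by linarith)]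
    · rw [longLegPosition, min_eq_right (by linarith), max_eq_right (by linarith)]
      ring
  fin_cases i
  · obtain ⟨a, b, c⟩ := hlong h1
    exact ⟨_, _, a, by simpa using b, Or.inl ⟨rfl, by simpa using c, by simp⟩⟩
  · obtain ⟨a, b, c⟩ := hlong h1
    exact ⟨_, _, a, by simpa using b, Or.inr ⟨rfl, by simp, by simpa using c⟩⟩
  · have h1' : t ≤ π / 4 := h1
    refine ⟨_, t + 3 * π / 4, ⟨by linarith, by linarith⟩, ?_, Or.inl ⟨rfl, ?_, by simp⟩⟩
    · simp [shortLegPosition, h0]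
    · have : longLegPosition (t + 3 * π / 4) = 0 := by
        rw [longLegPosition, max_eq_left]
        exact (min_le_right _ _).trans (by linarith)
      simp [this]

theorem exists_tripodCircleRel_right (p : IntrinsicCircle) : ∃ e, tripodCircleRel e p := by
  have hπ := pi_pos
  have hpoint : ∀ θ ∈ Icc 0 π, ∀ i : Fin 3, i ≠ 2 → π / 2 ≤ tripodLeg i →
      ∃ e : TripodE, e.1 2 = shortLegPosition θ ∧ e.1 i = longLegPosition θ ∧
        ∀ j, j ≠ i → j ≠ 2 → e.1 j = 0 := by
    intro θ hθ i hi hleg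
    rcases le_total θ (3 * π / 4) with h | h
    · have hmem : longLegPosition θ ∈ Icc 0 (tripodLeg i) := by
        refine ⟨longLegPosition_nonneg θ, hleg.trans' ?_⟩
        rw [longLegPosition, max_le_iff, min_le_iff]
        grind
      refine ⟨tripodPoint i _ hmem, ?_, by simp, fun j hj _ => by simp [hj]⟩
      rw [tripodPoint_apply, if_neg hi.symm, shortLegPosition, max_eq_left (by linarith)]
    · have hmem : shortLegPosition θ ∈ Icc 0 (tripodLeg 2) := by
        refine ⟨le_max_left _ _, max_le (tripodLeg_nonneg 2) ?_⟩
        have : tripodLeg 2 = π / 4 := rfl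
        linarith [hθ.2]
      refine ⟨tripodPoint 2 _ hmem, by simp, ?_, fun j _ hj => by simp [hj]⟩
      rw [tripodPoint_apply, if_neg hi, longLegPosition, max_eq_left]
      exact (min_le_right _ _).trans (by linarith)
  obtain ⟨θ, ⟨hθ0, hθ1⟩, rfl⟩ : ∃ θ ∈ Ioc (-π) π, (θ : IntrinsicCircle) = p := by
    have h := AddCircle.coe_image_Ioc_eq (2 * π) (-π)
    have hp : p ∈ ((↑) : ℝ → IntrinsicCircle) '' Ioc (-π) (-π + 2 * π) := by
      rw [h]
      trivial
    rwa [show -π + 2 * π = π by ring] at hp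
  rcases le_total 0 θ with h | h
  · obtain ⟨e, h₂, h₀, h₁⟩ := hpoint θ ⟨h, hθ1⟩ 0 (by decide) le_rfl
    exact ⟨e, θ, ⟨h, hθ1⟩, h₂, Or.inl ⟨rfl, h₀, h₁ 1 (by decide) (by decide)⟩⟩
  · obtain ⟨e, h₂, h₁, h₀⟩ := hpoint (-θ) ⟨by linarith, by linarith⟩ 1 (by decide) le_rfl
    exact ⟨e, -θ, ⟨by linarith, by linarith⟩, h₂,
      Or.inr ⟨by rw [neg_neg], h₀ 0 (by decide) (by decide), h₁⟩⟩

theorem exists_isCorrespondence_distortion_le {X : Type*} [MetricSpace X] [Nonempty X]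
    (hdiam : ∀ x y : X, dist x y ≤ π / 2) :
    ∃ R : Set ((X × TripodE) × IntrinsicCircle),
      IsCorrespondence R ∧ distortion R ≤ ENNReal.ofReal (π / 2) := by
  refine ⟨{q | tripodCircleRel q.1.2 q.2}, ⟨fun z => exists_tripodCircleRel_left z.2, fun p => ?_⟩,
    ?_⟩
  · obtain ⟨e, he⟩ := exists_tripodCircleRel_right p
    exact ⟨(Classical.arbitrary X, e), he⟩
  · refine iSup₂_le fun ⟨⟨⟨x, e⟩, p⟩, h⟩ ⟨⟨⟨x', e'⟩, p'⟩, h'⟩ => ENNReal.ofReal_le_ofReal ?_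
    have hd := abs_le.1 (abs_dist_sub_dist_le_of_tripodCircleRel h h')
    have hp : 0 ≤ dist p p' := dist_nonneg
    rw [Prod.dist_eq, abs_le]
    refine ⟨?_, ?_⟩
    · linarith [hd.1, le_max_right (dist x x') (dist e e')]
    · rw [sub_le_iff_le_add]
      exact max_le (by linarith [hdiam x x']) (by linarith [hd.2])

/-- **Corollary 4.2.** For any nonempty simply connected geodesic space `X` with
`diam X ≤ π/2`, the product `X × E` (with the `max` metric, which is the product metric
in Mathlib) is a simply connected geodesic space with `d_GH(X × E, S¹) = π/4`. -/
theorem prod_tripod_ghDist_circle {X : Type*} [MetricSpace X] [Nonempty X]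
    (hgeo : IsGeodesicSpace X) (hsc : SimplyConnectedSpace X)
    (hdiam : EMetric.diam (Set.univ : Set X) ≤ ENNReal.ofReal (π / 2)) :
    SimplyConnectedSpace (X × TripodE) ∧ IsGeodesicSpace (X × TripodE) ∧
      ghDist (X × TripodE) IntrinsicCircle = ENNReal.ofReal (π / 4) := by
  have hd : ∀ x y : X, dist x y ≤ π / 2 := fun x y => by
    have h : edist x y ≤ ENNReal.ofReal (π / 2) :=
      (Metric.edist_le_ediam_of_mem (mem_univ x) (mem_univ y)).trans hdiam
    rwa [edist_dist, ENNReal.ofReal_le_ofReal_iff (by positivity)] at h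
  refine ⟨.prod, hgeo.prod isGeodesicSpace_tripodE, ?_⟩
  have hinf : ⨅ R : {R : Set ((X × TripodE) × IntrinsicCircle) // IsCorrespondence R},
      distortion (R : Set ((X × TripodE) × IntrinsicCircle)) = ENNReal.ofReal (π / 2) := by
    obtain ⟨R, hR, hle⟩ := exists_isCorrespondence_distortion_le hd
    exact le_antisymm (iInf_le_of_le ⟨R, hR⟩ hle)
      (le_iInf fun R => le_distortion_of_isCorrespondence hd R.2)
  rw [ghDist, hinf, ← ENNReal.ofReal_ofNat 2, ← ENNReal.ofReal_div_of_pos two_pos]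
  congr 1
  ring

end
end

section
/- Let (X, d_X) be a nonempty simply connected geodesic space with diam(X) ≤ π/2, let E be the metric tripod obtained by gluing three segments of lengths π/2, π/2 and π/4 at a common endpoint, and equip X × E with the metric d((x,e),(x',e')) = max(d_X(x,x'), d_E(e,e')). Then every subspace Z ⊆ X × E which (with the induced metric) is a geodesic, simply connected space and whose coordinate projection π_E : Z → E is surjective satisfies d_GH(Z, S¹) = π/4. -/
open Real Set Metric
open scoped ENNReal unitInterval

noncomputable section

section Lower

variable {Z : Type*} [MetricSpace Z]

theorem IsGeodesicSpace.exists_path (hZ : IsGeodesicSpace Z) (x y : Z) :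
    ∃ γ : Path x y, ∀ t, dist x (γ t) + dist (γ t) y ≤ dist x y := by
  obtain ⟨γ, hγ, h0, h1, hlen⟩ := hZ x y
  refine ⟨⟨⟨fun t => γ t, hγ.domRestrict⟩, by simpa using h0, by simpa using h1⟩, ?_⟩
  intro t
  have key := eVariationOn.Icc_add_Icc γ (s := Icc 0 1) t.2.1 t.2.2 t.2
  rw [inter_self, hlen] at key
  have hl := eVariationOn.edist_le γ (s := Icc (0 : ℝ) 1 ∩ Icc 0 t)
    (x := 0) (y := t) (by simp [t.2.1]) (by simp [t.2.1])
  have hr := eVariationOn.edist_le γ (s := Icc (0 : ℝ) 1 ∩ Icc t 1)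
    (x := t) (y := 1) (by simp [t.2.2]) (by simp [t.2.2])
  have h := (add_le_add hl hr).trans_eq key
  rw [h0, h1, edist_dist, edist_dist, ← ENNReal.ofReal_add dist_nonneg dist_nonneg] at h
  exact (ENNReal.ofReal_le_ofReal_iff dist_nonneg).1 h

theorem IsGeodesicSpace.exists_midpoint (hZ : IsGeodesicSpace Z) (x y : Z) :
    ∃ m, dist x m ≤ dist x y / 2 ∧ dist m y ≤ dist x y / 2 := by
  obtain ⟨γ, hγ⟩ := hZ.exists_path x y
  have hc : Continuous fun t => dist x (γ t) := by fun_prop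
  obtain ⟨t, ht⟩ := mem_range_of_exists_le_of_exists_ge hc (c := dist x y / 2)
    ⟨0, by simp [div_nonneg]⟩ ⟨1, by simp⟩
  have := hγ t
  exact ⟨γ t, ht.le, by linarith⟩

theorem IsGeodesicSpace.locallyPathConnectedSpace (hZ : IsGeodesicSpace Z) :
    LocallyPathConnectedSpace Z := by
  refine .of_bases (fun x => nhds_basis_ball) fun x r hr => ⟨x, mem_ball_self hr, ?_⟩
  intro y hy
  obtain ⟨γ, hγ⟩ := hZ.exists_path x y
  refine ⟨γ, fun t => ?_⟩
  have := hγ t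
  rw [mem_ball, dist_comm] at hy ⊢
  linarith [dist_nonneg (x := γ t) (y := y)]

theorem exists_abs_sub_eq_dist_coe (a b : ℝ) :
    ∃ n : ℤ, |a - b - n * (2 * π)| = dist (a : IntrinsicCircle) b :=
  ⟨round ((2 * π)⁻¹ * (a - b)), by rw [dist_eq_norm, ← AddCircle.coe_sub, AddCircle.norm_eq]⟩

/-- Two reals less than a full turn minus `r` apart, whose classes in the circle are at distance
at most `r`, are themselves at distance at most `r`. -/
theorem abs_sub_le_of_dist_coe_le {a b r : ℝ} (h : dist (a : IntrinsicCircle) b ≤ r)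
    (hab : |a - b| < 2 * π - r) : |a - b| ≤ r := by
  obtain ⟨n, hn⟩ := exists_abs_sub_eq_dist_coe a b
  rw [← hn] at h
  have hlt : |(n : ℝ)| < 1 := by
    have h2 : |(n : ℝ) * (2 * π)| < 2 * π := by
      calc |(n : ℝ) * (2 * π)| = |(a - b) - (a - b - n * (2 * π))| := by ring_nf
        _ ≤ |a - b| + |a - b - n * (2 * π)| := abs_sub _ _
        _ < 2 * π := by linarith
    rw [abs_mul, abs_of_pos Real.two_pi_pos] at h2
    nlinarith [Real.pi_pos]
  have : n = 0 := by exact_mod_cast Int.abs_lt_one_iff.1 (by exact_mod_cast hlt)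
  simpa [this] using h

theorem cos_sub_pos_of_dist_coe_lt {a b : ℝ} (h : dist (a : IntrinsicCircle) b < π / 2) :
    0 < Real.cos (a - b) := by
  obtain ⟨n, hn⟩ := exists_abs_sub_eq_dist_coe a b
  rw [← Real.cos_sub_int_mul_two_pi _ n]
  rw [← hn, abs_lt] at h
  exact Real.cos_pos_of_mem_Ioo h

theorem exists_coe_eq_of_cos_sub_pos {a b : ℝ} (h : 0 < Real.cos (a - b)) :
    ∃ c : ℝ, (c : IntrinsicCircle) = a ∧ |c - b| < π / 2 := by
  obtain ⟨n, hn⟩ := exists_abs_sub_eq_dist_coe a b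
  refine ⟨a - n * (2 * π), ?_, ?_⟩
  · simp [← zsmul_eq_mul, AddCircle.coe_period]
  · rw [sub_right_comm]
    by_contra! hge
    rw [← Real.cos_sub_int_mul_two_pi _ n, ← Real.cos_abs] at h
    refine h.not_ge (Real.cos_nonpos_of_pi_div_two_le_of_le hge ?_)
    rw [hn, dist_eq_norm]
    have := AddCircle.norm_le_half_period (2 * π) (x := (a : IntrinsicCircle) - b)
      Real.two_pi_pos.ne'
    rw [abs_of_pos Real.two_pi_pos] at this
    linarith [Real.pi_pos]

/-- The circle has no continuous section into its universal cover. -/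
theorem not_continuous_section_circle (s : IntrinsicCircle → ℝ)
    (hs : ∀ y, (s y : IntrinsicCircle) = y) : ¬ Continuous s := by
  intro hc
  have hcov : IsCoveringMap ((↑) : ℝ → IntrinsicCircle) := AddCircle.isCoveringMap_coe _
  have h := hcov.eq_of_comp_eq (A := ℝ) (g₁ := fun t => s t) (g₂ := fun t => t + s 0)
    (hc.comp (AddCircle.continuous_mk' _)) (by fun_prop)
    (by ext t; simp [hs]) 0 (by simp)
  have h2 := congrFun h (2 * π)
  simp only [AddCircle.coe_period] at h2
  linarith [Real.pi_pos]

variable {R : Set (Z × IntrinsicCircle)} {D : ℝ}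

/-- A relation of distortion less than `π / 2` from a simply connected geodesic space to the
circle is within `π / 2` of a continuous map that lifts to the real line. -/
theorem exists_continuous_lift_near (hZ : IsGeodesicSpace Z) [SimplyConnectedSpace Z]
    (hR : IsCorrespondence R) (hD : D < π / 2)
    (hdis : ∀ p ∈ R, ∀ q ∈ R, |dist p.1 q.1 - dist p.2 q.2| ≤ D) :
    ∃ θ : Z → ℝ, Continuous θ ∧ ∀ z (b : ℝ), (z, (b : IntrinsicCircle)) ∈ R →
      0 < Real.cos (b - θ z) := by
  have := hZ.locallyPathConnectedSpace
  obtain ⟨F, hF⟩ := exists_continuous_forall_mem_convex_of_local_const (X := Z) (E := ℂ)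
    (t := fun z => {w | ∀ b : ℝ, (z, (b : IntrinsicCircle)) ∈ R →
      0 < w.re * Real.cos b + w.im * Real.sin b}) (by
    intro z
    simp only [ofPred_forall]
    refine convex_iInter₂ fun b _ => ?_
    intro w hw w' hw' s t hs ht hst
    simp only [mem_ofPred_eq, Complex.add_re, Complex.add_im, Complex.smul_re, Complex.smul_im,
      smul_eq_mul] at *
    have h2 : 0 ≤ t * (w'.re * Real.cos b + w'.im * Real.sin b) := by positivity
    rcases hs.eq_or_lt with rfl | hs
    · obtain rfl : t = 1 := by linarith
      linarith
    · have h1 : 0 < s * (w.re * Real.cos b + w.im * Real.sin b) := by positivity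
      linarith) (by
    intro z
    obtain ⟨y, hy⟩ := hR.1 z
    obtain ⟨a, rfl⟩ := QuotientAddGroup.mk_surjective y
    refine ⟨⟨Real.cos a, Real.sin a⟩, ?_⟩
    filter_upwards [ball_mem_nhds z (sub_pos.2 hD)] with z' hz' b hb
    rw [← Real.cos_sub]
    refine cos_sub_pos_of_dist_coe_lt ?_
    have : -D ≤ dist z z' - dist (a : IntrinsicCircle) b := (abs_le.1 (hdis _ hy _ hb)).1
    rw [mem_ball'] at hz'
    linarith)
  have hF0 : ∀ z, F z ≠ 0 := by
    intro z hz
    obtain ⟨y, hy⟩ := hR.1 z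
    obtain ⟨a, rfl⟩ := QuotientAddGroup.mk_surjective y
    simpa [hz] using hF z a hy
  let f : C(Z, IntrinsicCircle) := ⟨fun z => ((F z).arg : Real.Angle),
    continuous_iff_continuousAt.2 fun z =>
      (Complex.continuousAt_arg_coe_angle (hF0 z)).comp F.continuous.continuousAt⟩
  obtain ⟨z₀⟩ : Nonempty Z := inferInstance
  have hcov : IsCoveringMap ((↑) : ℝ → IntrinsicCircle) := AddCircle.isCoveringMap_coe _
  obtain ⟨θ, ⟨-, hθ⟩, -⟩ := hcov.existsUnique_continuousMap_lifts f z₀ (F z₀).arg rfl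
  refine ⟨θ, θ.continuous, fun z b hb => ?_⟩
  have hang : ((θ z : ℝ) : Real.Angle) = ((F z).arg : Real.Angle) := congrFun hθ z
  have hpos := hF z b hb
  rw [← Real.cos_neg, neg_sub, Real.cos_sub, ← Real.Angle.cos_coe, ← Real.Angle.sin_coe (θ z), hang,
    Real.Angle.cos_coe, Real.Angle.sin_coe, Complex.cos_arg (hF0 z), Complex.sin_arg]
  have hn : 0 < ‖F z‖ := norm_pos_iff.2 (hF0 z)
  rw [div_mul_eq_mul_div, div_mul_eq_mul_div, ← add_div]
  exact div_pos hpos hn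

/-- `b` is the representative, closest to `θ z`, of a point of the circle related to `z`. -/
def IsNearLift (R : Set (Z × IntrinsicCircle)) (θ : Z → ℝ) (z : Z) (b : ℝ) : Prop :=
  (z, (b : IntrinsicCircle)) ∈ R ∧ |b - θ z| < π / 2

variable {θ : Z → ℝ}

theorem IsNearLift.dist_coe_le
    (hdis : ∀ p ∈ R, ∀ q ∈ R, |dist p.1 q.1 - dist p.2 q.2| ≤ D) {z z' : Z} {b b' : ℝ}
    (h : IsNearLift R θ z b) (h' : IsNearLift R θ z' b') :
    dist (b : IntrinsicCircle) b' ≤ D + dist z z' := by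
  have : -D ≤ dist z z' - dist (b : IntrinsicCircle) b' := (abs_le.1 (hdis _ h.1 _ h'.1)).1
  linarith

theorem IsNearLift.abs_sub_lt_of_close
    (hdis : ∀ p ∈ R, ∀ q ∈ R, |dist p.1 q.1 - dist p.2 q.2| ≤ D) {z z' : Z} {b b' : ℝ}
    (h : IsNearLift R θ z b) (h' : IsNearLift R θ z' b') (hz : dist z z' < π / 2 - D)
    (hθ : |θ z - θ z'| < π / 2) : |b - b'| < π / 2 := by
  have h1 := h.dist_coe_le hdis h'
  refine (abs_sub_le_of_dist_coe_le h1 ?_).trans_lt (by linarith)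
  have h2 := abs_lt.1 h.2
  have h3 := abs_lt.1 h'.2
  have h4 := abs_lt.1 hθ
  rw [abs_lt]
  constructor <;> linarith

theorem IsNearLift.abs_sub_lt_of_geodesic (hZ : IsGeodesicSpace Z) (hD : D < π / 2)
    (hdis : ∀ p ∈ R, ∀ q ∈ R, |dist p.1 q.1 - dist p.2 q.2| ≤ D) (hθ : Continuous θ)
    (hex : ∀ z, ∃ b, IsNearLift R θ z b) {z z' : Z} {b b' : ℝ}
    (h : IsNearLift R θ z b) (h' : IsNearLift R θ z' b') (hz : D + dist z z' < 3 * π / 4) :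
    |b - b'| < 3 * π / 4 := by
  obtain ⟨γ, hγ⟩ := hZ.exists_path z z'
  choose g hg using hex
  have hπ := Real.pi_pos
  have hfar : ∀ w c, dist z w ≤ dist z z' → IsNearLift R θ w c → |b - c| < 5 * π / 4 →
      |b - c| < 3 * π / 4 := by
    intro w c hw hc hlt
    have h1 := h.dist_coe_le hdis hc
    exact (abs_sub_le_of_dist_coe_le h1 (by linarith)).trans_lt (by linarith)
  have hle : ∀ t, dist z (γ t) ≤ dist z z' := fun t => by
    linarith [hγ t, dist_nonneg (x := γ t) (y := z')]
  have hstep : ∀ t t', |g (γ t) - g (γ t')| < π / 2 → |b - g (γ t)| < 3 * π / 4 →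
      |b - g (γ t')| < 3 * π / 4 := by
    intro t t' h1 h2
    refine hfar _ _ (hle t') (hg _) ?_
    have := abs_sub_le b (g (γ t)) (g (γ t'))
    linarith
  have hloc : IsLocallyConstant fun t => |b - g (γ t)| < 3 * π / 4 := by
    rw [IsLocallyConstant.iff_eventually_eq]
    intro t
    have e1 : ∀ᶠ t' in nhds t, γ t' ∈ ball (γ t) (π / 2 - D) :=
      γ.continuous.continuousAt.eventually_mem (ball_mem_nhds _ (by linarith))
    have e2 : ∀ᶠ t' in nhds t, θ (γ t') ∈ ball (θ (γ t)) (π / 2) :=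
      (hθ.comp γ.continuous).continuousAt.eventually_mem (ball_mem_nhds _ (by linarith))
    filter_upwards [e1, e2] with t' h1 h2
    have h3 := (hg (γ t')).abs_sub_lt_of_close hdis (hg (γ t)) h1 (by
      rwa [mem_ball, Real.dist_eq] at h2)
    exact propext ⟨hstep _ _ h3, hstep _ _ (by rwa [abs_sub_comm])⟩
  have hself : ∀ {w c c'}, IsNearLift R θ w c → IsNearLift R θ w c' → |c - c'| < π / 2 :=
    fun h1 h2 => h1.abs_sub_lt_of_close hdis h2 (by simpa using hD) (by simpa using hπ)
  have h0 : |b - g (γ 0)| < 3 * π / 4 :=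
    (hself h (by simpa using hg (γ 0))).trans (by linarith)
  have h1 : |b - g (γ 1)| < 3 * π / 4 := hloc.apply_eq_of_preconnectedSpace 0 1 ▸ h0
  refine hfar _ _ le_rfl h' ?_
  have h2 : |g (γ 1) - b'| < π / 2 := hself (hg _) (by simpa using h')
  have := abs_sub_le b (g (γ 1)) b'
  linarith

theorem IsNearLift.abs_sub_le (hZ : IsGeodesicSpace Z) (hD : D < π / 2) (hD0 : 0 ≤ D)
    (hdis : ∀ p ∈ R, ∀ q ∈ R, |dist p.1 q.1 - dist p.2 q.2| ≤ D) (hθ : Continuous θ)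
    (hex : ∀ z, ∃ b, IsNearLift R θ z b) {z z' : Z} {b b' : ℝ}
    (h : IsNearLift R θ z b) (h' : IsNearLift R θ z' b')
    (hb : dist (b : IntrinsicCircle) b' < π / 2 - D) :
    |b - b'| ≤ dist (b : IntrinsicCircle) b' := by
  obtain ⟨m, hm, hm'⟩ := hZ.exists_midpoint z z'
  obtain ⟨c, hc⟩ := hex m
  have hzz : dist z z' - dist (b : IntrinsicCircle) b' ≤ D := (abs_le.1 (hdis _ h.1 _ h'.1)).2
  have h1 := h.abs_sub_lt_of_geodesic hZ hD hdis hθ hex hc (by linarith)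
  have h2 := hc.abs_sub_lt_of_geodesic hZ hD hdis hθ hex h' (by linarith)
  have := _root_.abs_sub_le b c b'
  exact abs_sub_le_of_dist_coe_le le_rfl (by linarith)

/-- A correspondence between a simply connected geodesic space and the circle has distortion at
least `π / 2`. -/
theorem pi_div_two_le_distortion (hZ : IsGeodesicSpace Z) [SimplyConnectedSpace Z]
    (hR : IsCorrespondence R) : ENNReal.ofReal (π / 2) ≤ distortion R := by
  by_contra! hlt
  set D := (distortion R).toReal with hDdef
  have hD : D < π / 2 := by
    have := ENNReal.toReal_strict_mono ENNReal.ofReal_ne_top hlt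
    rwa [ENNReal.toReal_ofReal (by positivity)] at this
  have hdis : ∀ p ∈ R, ∀ q ∈ R, |dist p.1 q.1 - dist p.2 q.2| ≤ D := by
    intro p hp q hq
    rw [← ENNReal.ofReal_le_iff_le_toReal hlt.ne_top]
    exact le_iSup₂ (f := fun (p q : R) => ENNReal.ofReal
      |dist (p : Z × IntrinsicCircle).1 (q : Z × IntrinsicCircle).1 -
        dist (p : Z × IntrinsicCircle).2 (q : Z × IntrinsicCircle).2|) ⟨p, hp⟩ ⟨q, hq⟩
  obtain ⟨θ, hθ, hcos⟩ := exists_continuous_lift_near hZ hR hD hdis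
  have hnear : ∀ z y, (z, y) ∈ R → ∃ b : ℝ, (b : IntrinsicCircle) = y ∧ IsNearLift R θ z b := by
    intro z y hy
    obtain ⟨a, rfl⟩ := QuotientAddGroup.mk_surjective y
    obtain ⟨c, hc, hcθ⟩ := exists_coe_eq_of_cos_sub_pos (hcos z a hy)
    refine ⟨c, hc, ?_, hcθ⟩
    rw [hc]
    exact hy
  have hex : ∀ z, ∃ b, IsNearLift R θ z b := fun z => by
    obtain ⟨y, hy⟩ := hR.1 z
    obtain ⟨b, -, hb⟩ := hnear z y hy
    exact ⟨b, hb⟩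
  choose x hx using hR.2
  choose s hs hsn using fun y => hnear (x y) y (hx y)
  refine not_continuous_section_circle s hs ?_
  rw [Metric.continuous_iff]
  intro y ε hε
  refine ⟨min ε (π / 2 - D), lt_min hε (by linarith), fun y' hy' => ?_⟩
  have h := (hsn y').abs_sub_le hZ hD ENNReal.toReal_nonneg hdis hθ hex (hsn y)
    (by rw [hs, hs]; exact hy'.trans_le (min_le_right _ _))
  rw [hs, hs] at h
  rw [Real.dist_eq]
  exact h.trans_lt (hy'.trans_le (min_le_left _ _))

end Lower

section Upper

/-- A curve running through the tripod: it starts halfway up the first long leg and goes to its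
tip, then through the center up and down the short leg, then to the tip of the second long leg,
and ends halfway down this leg. -/
def tripodCurve (u : ℝ) : PiLp 1 fun _ : Fin 3 => ℝ :=
  WithLp.toLp 1 ![max 0 (π / 2 - |u - π / 4|), max 0 (π / 2 - |u - 7 * π / 4|),
    max 0 (π / 4 - |u - π|)]

theorem tripodCurve_mem {u : ℝ} (h0 : 0 ≤ u) (h1 : u ≤ 2 * π) : tripodCurve u ∈ TripodSet := by
  have hπ := Real.pi_pos
  rcases le_or_gt u (3 * π / 4) with h | h
  · refine ⟨0, π / 2 - |u - π / 4|, ?_, ?_, ?_⟩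
    · simp only [sub_nonneg, abs_le]
      constructor <;> linarith
    · simp [tripodLeg]
    · ext j
      fin_cases j <;> simp [tripodCurve] <;> grind
  rcases le_or_gt u (5 * π / 4) with h' | h'
  · refine ⟨2, π / 4 - |u - π|, ?_, ?_, ?_⟩
    · simp only [sub_nonneg, abs_le]
      constructor <;> linarith
    · simp [tripodLeg]
    · ext j
      fin_cases j <;> simp [tripodCurve] <;> grind
  · refine ⟨1, π / 2 - |u - 7 * π / 4|, ?_, ?_, ?_⟩
    · simp only [sub_nonneg, abs_le]
      constructor <;> linarith
    · simp [tripodLeg]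
    · ext j
      fin_cases j <;> simp [tripodCurve] <;> grind

theorem exists_tripodCurve_eq (e : TripodE) : ∃ u ∈ Icc 0 (2 * π), tripodCurve u = e := by
  have hπ := Real.pi_pos
  obtain ⟨e, i, t, h0, h1, rfl⟩ := e
  fin_cases i <;> simp [tripodLeg] at h1
  · refine ⟨3 * π / 4 - t, ⟨by linarith, by linarith⟩, ?_⟩
    ext j
    fin_cases j <;> simp [tripodCurve] <;> grind
  · refine ⟨5 * π / 4 + t, ⟨by linarith, by linarith⟩, ?_⟩
    ext j
    fin_cases j <;> simp [tripodCurve] <;> grind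
  · refine ⟨3 * π / 4 + t, ⟨by linarith, by linarith⟩, ?_⟩
    ext j
    fin_cases j <;> simp [tripodCurve] <;> grind

theorem dist_tripodCurve (u v : ℝ) : dist (tripodCurve u) (tripodCurve v) =
    |max 0 (π / 2 - |u - π / 4|) - max 0 (π / 2 - |v - π / 4|)| +
    |max 0 (π / 2 - |u - 7 * π / 4|) - max 0 (π / 2 - |v - 7 * π / 4|)| +
    |max 0 (π / 4 - |u - π|) - max 0 (π / 4 - |v - π|)| := by
  simp [PiLp.dist_eq_of_L1, Fin.sum_univ_three, tripodCurve, Real.dist_eq]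

theorem abs_tent_sub_le (c : ℝ) {r u v : ℝ} (hr : 0 ≤ r) (huv : u ≤ v) :
    |max 0 (r - |u - c|) - max 0 (r - |v - c|)| ≤
      max (c - r) (min v (c + r)) - max (c - r) (min u (c + r)) := by
  rw [abs_le]
  constructor <;> grind (splits := 20)

theorem dist_tripodCurve_le (u v : ℝ) : dist (tripodCurve u) (tripodCurve v) ≤ |u - v| := by
  wlog huv : u ≤ v generalizing u v
  · rw [dist_comm, abs_sub_comm]
    exact this v u (le_of_not_ge huv)
  rw [dist_tripodCurve, abs_sub_comm u v, abs_of_nonneg (sub_nonneg.2 huv)]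
  have hπ := Real.pi_pos
  have hsum : ∀ w : ℝ, max (π / 4 - π / 2) (min w (π / 4 + π / 2)) +
      max (7 * π / 4 - π / 2) (min w (7 * π / 4 + π / 2)) +
      max (π - π / 4) (min w (π + π / 4)) = max (-π / 4) (min w (9 * π / 4)) + 2 * π := by
    grind (splits := 20)
  have hclamp : max (-π / 4) (min v (9 * π / 4)) - max (-π / 4) (min u (9 * π / 4)) ≤ v - u := by
    grind (splits := 20)
  have hb := abs_tent_sub_le (π / 4) (half_pos hπ).le huv
  have ha := abs_tent_sub_le (7 * π / 4) (half_pos hπ).le huv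
  have hc := abs_tent_sub_le π (by positivity : 0 ≤ π / 4) huv
  linarith [hsum u, hsum v]

theorem dist_tripodCurve_endpoints : dist (tripodCurve 0) (tripodCurve (2 * π)) = π / 2 := by
  have hπ := Real.pi_pos
  rw [dist_tripodCurve]
  grind

theorem le_dist_tripodCurve_add_pi {u : ℝ} (h0 : 0 ≤ u) (h1 : u ≤ π) :
    π / 2 ≤ dist (tripodCurve u) (tripodCurve (u + π)) := by
  rw [dist_tripodCurve]
  rcases le_or_gt u (π / 4) with h | h
  · grind
  rcases le_or_gt u (3 * π / 4) with h' | h' <;> grind (splits := 20)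

theorem dist_coe_circle {u v : ℝ} (hu : u ∈ Icc 0 (2 * π)) (hv : v ∈ Icc 0 (2 * π)) :
    dist (u : IntrinsicCircle) v = min |u - v| (2 * π - |u - v|) := by
  wlog huv : v ≤ u generalizing u v
  · rw [dist_comm, abs_sub_comm]
    exact this hv hu (le_of_not_ge huv)
  have hπ := Real.pi_pos
  obtain ⟨hu0, hu1⟩ := hu
  obtain ⟨hv0, hv1⟩ := hv
  have hnorm : ∀ x : ℝ, |x| ≤ π → ‖(x : IntrinsicCircle)‖ = |x| := fun x hx =>
    (AddCircle.norm_coe_eq_abs_iff (2 * π) Real.two_pi_pos.ne').2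
      (by rw [abs_of_pos Real.two_pi_pos]; linarith)
  rw [dist_eq_norm, ← AddCircle.coe_sub, abs_of_nonneg (sub_nonneg.2 huv)]
  rcases le_total (u - v) π with h | h
  · rw [hnorm _ (by rwa [abs_of_nonneg (sub_nonneg.2 huv)]), abs_of_nonneg (sub_nonneg.2 huv),
      min_eq_left (by linarith)]
  · have hx : ((u - v : ℝ) : IntrinsicCircle) = ((u - v - 2 * π : ℝ) : IntrinsicCircle) := by
      rw [AddCircle.coe_sub (2 * π) (u - v), AddCircle.coe_period, sub_zero]
    have habs : |u - v - 2 * π| = 2 * π - (u - v) := by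
      rw [abs_of_nonpos (by linarith)]
      ring
    rw [hx, hnorm _ (by rw [habs]; linarith), habs, min_eq_right (by linarith)]

theorem abs_dist_tripodCurve_sub_le {u v : ℝ} (hu : u ∈ Icc 0 (2 * π)) (hv : v ∈ Icc 0 (2 * π)) :
    |dist (tripodCurve u) (tripodCurve v) - dist (u : IntrinsicCircle) v| ≤ π / 2 := by
  wlog huv : u ≤ v generalizing u v
  · rw [dist_comm, dist_comm (u : IntrinsicCircle)]
    exact this hv hu (le_of_not_ge huv)
  have hπ := Real.pi_pos
  obtain ⟨hu0, hu1⟩ := hu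
  obtain ⟨hv0, hv1⟩ := hv
  rw [dist_coe_circle ⟨hu0, hu1⟩ ⟨hv0, hv1⟩, abs_sub_comm u v, abs_of_nonneg (sub_nonneg.2 huv),
    abs_le]
  have hlip := dist_tripodCurve_le u v
  rw [abs_sub_comm u v, abs_of_nonneg (sub_nonneg.2 huv)] at hlip
  constructor
  · have hnn := dist_nonneg (x := tripodCurve u) (y := tripodCurve v)
    have hmin1 := min_le_left (v - u) (2 * π - (v - u))
    have hmin2 := min_le_right (v - u) (2 * π - (v - u))
    rcases le_total u π with h | h
    · have hanti := le_dist_tripodCurve_add_pi hu0 h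
      have htri := dist_triangle (tripodCurve u) (tripodCurve v) (tripodCurve (u + π))
      have hl := dist_tripodCurve_le v (u + π)
      rcases abs_cases (v - (u + π)) with ⟨he, -⟩ | ⟨he, -⟩ <;> rw [he] at hl <;> linarith
    · have hanti := le_dist_tripodCurve_add_pi (u := v - π) (by linarith) (by linarith)
      rw [sub_add_cancel] at hanti
      have htri := dist_triangle (tripodCurve (v - π)) (tripodCurve u) (tripodCurve v)
      have hl := dist_tripodCurve_le (v - π) u
      rcases abs_cases (v - π - u) with ⟨he, -⟩ | ⟨he, -⟩ <;> rw [he] at hl <;> linarith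
  · rw [sub_le_iff_le_add, add_comm, ← sub_le_iff_le_add]
    refine le_min (by linarith) ?_
    have htri := dist_triangle4 (tripodCurve u) (tripodCurve 0) (tripodCurve (2 * π))
      (tripodCurve v)
    have h1 := dist_tripodCurve_le u 0
    have h2 := dist_tripodCurve_le (2 * π) v
    rw [sub_zero, abs_of_nonneg hu0] at h1
    rw [abs_of_nonneg (by linarith)] at h2
    rw [dist_tripodCurve_endpoints] at htri
    linarith

/-- A subspace of `X × E` projecting onto the tripod `E` is related to the circle through a
correspondence of distortion at most `π / 2`, if the diameter of `X` is at most `π / 2`. -/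
theorem exists_correspondence_distortion_le {X : Type*} [MetricSpace X]
    (hdiam : Metric.ediam (Set.univ : Set X) ≤ ENNReal.ofReal (π / 2))
    (S : Set (X × TripodE)) (hSproj : ∀ e : TripodE, ∃ p ∈ S, p.2 = e) :
    ∃ R : Set (S × IntrinsicCircle), IsCorrespondence R ∧
      distortion R ≤ ENNReal.ofReal (π / 2) := by
  refine ⟨{p | ∃ u ∈ Icc 0 (2 * π), tripodCurve u = p.1.1.2 ∧ (u : IntrinsicCircle) = p.2},
    ⟨fun z => ?_, fun y => ?_⟩, ?_⟩
  · obtain ⟨u, hu, he⟩ := exists_tripodCurve_eq z.1.2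
    exact ⟨u, u, hu, he, rfl⟩
  · obtain ⟨u, hu, rfl⟩ := AddCircle.coe_image_Icc_eq (2 * π) 0 ▸ mem_univ y
    rw [zero_add] at hu
    obtain ⟨p, hp, he⟩ := hSproj ⟨tripodCurve u, tripodCurve_mem hu.1 hu.2⟩
    exact ⟨⟨p, hp⟩, u, hu, by simp [he], rfl⟩
  · refine iSup₂_le ?_
    rintro ⟨⟨z, y⟩, u, hu, he, hy⟩ ⟨⟨z', y'⟩, v, hv, he', hy'⟩
    refine ENNReal.ofReal_le_ofReal ?_
    change tripodCurve u = z.1.2 at he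
    change tripodCurve v = z'.1.2 at he'
    change |dist z z' - dist y y'| ≤ π / 2
    obtain rfl : (u : IntrinsicCircle) = y := hy
    obtain rfl : (v : IntrinsicCircle) = y' := hy'
    have hX : dist z.1.1 z'.1.1 ≤ π / 2 := by
      have h := (Metric.edist_le_ediam_of_mem (mem_univ z.1.1) (mem_univ z'.1.1)).trans hdiam
      rwa [edist_dist, ENNReal.ofReal_le_ofReal_iff (by positivity)] at h
    have hE : dist z.1.2 z'.1.2 = dist (tripodCurve u) (tripodCurve v) := by
      rw [Subtype.dist_eq, he, he']
    have hE' := abs_le.1 (abs_dist_tripodCurve_sub_le hu hv)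
    have hnn := dist_nonneg (x := (u : IntrinsicCircle)) (y := v)
    rw [Subtype.dist_eq, Prod.dist_eq, hE, abs_le, sub_le_iff_le_add]
    refine ⟨?_, max_le (by linarith) (by linarith)⟩
    linarith [le_max_right (dist z.1.1 z'.1.1) (dist (tripodCurve u) (tripodCurve v))]

end Upper

/-- **Note 4.3.** Any geodesic, simply connected subspace `S ⊆ X × E` (product `max`
metric; `X` nonempty, simply connected, geodesic, of diameter `≤ π/2`) whose coordinate
projection to `E` is surjective satisfies `d_GH(S, S¹) = π/4`. -/
theorem subspace_of_prod_tripod_ghDist_circle {X : Type*} [MetricSpace X] [Nonempty X]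
    (hgeo : IsGeodesicSpace X) (hsc : SimplyConnectedSpace X)
    (hdiam : EMetric.diam (Set.univ : Set X) ≤ ENNReal.ofReal (π / 2))
    (S : Set (X × TripodE))
    (hSgeo : IsGeodesicSpace S) (hSsc : SimplyConnectedSpace S)
    (hSproj : ∀ e : TripodE, ∃ p ∈ S, p.2 = e) :
    ghDist S IntrinsicCircle = ENNReal.ofReal (π / 4) := by
  have hhalf : ENNReal.ofReal (π / 4) = ENNReal.ofReal (π / 2) / 2 := by
    rw [← ENNReal.ofReal_ofNat 2, ← ENNReal.ofReal_div_of_pos two_pos]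
    ring_nf
  rw [hhalf, ghDist]
  congr 1
  refine le_antisymm ?_ (le_iInf fun R => pi_div_two_le_distortion hSgeo R.2)
  obtain ⟨R, hR, hRdis⟩ := exists_correspondence_distortion_le hdiam S hSproj
  exact (iInf_le _ (⟨R, hR⟩ : {R : Set (S × IntrinsicCircle) // IsCorrespondence R})).trans hRdis

end
end

section
/- Let (X, d_X) be a complete ℝ-tree of length at most 5π/4 such that d_GH(X, S¹) = π/4. Then X is isometric to the metric tripod E obtained by gluing three segments of lengths π/2, π/2 and π/4 at a common endpoint. -/
open Real Set Metric
open scoped ENNReal unitInterval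

noncomputable section

/-- The metric interval between two points. -/
def metricInterval {X : Type*} [MetricSpace X] (a b : X) : Set X :=
  {v | dist a v + dist v b = dist a b}

/-- `γ` restricts to an isometric embedding of `[0, L]`. -/
def IsGeodesicOn {X : Type*} [MetricSpace X] (γ : ℝ → X) (L : ℝ) : Prop :=
  ∀ s ∈ Set.Icc 0 L, ∀ t ∈ Set.Icc 0 L, dist (γ s) (γ t) = |s - t|

/-- The four-point condition (`0`-hyperbolicity). -/
def FourPoint (X : Type*) [MetricSpace X] : Prop :=
  ∀ x y z w : X, dist x y + dist z w ≤ max (dist x z + dist y w) (dist x w + dist y z)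

theorem isArcBetween_image {X : Type*} [TopologicalSpace X] {f : ℝ → X} {L : ℝ} (hL : 0 < L)
    (hc : ContinuousOn f (Set.Icc 0 L)) (hi : Set.InjOn f (Set.Icc 0 L)) :
    IsArcBetween (f 0) (f L) (f '' Set.Icc 0 L) := by
  have hmem : ∀ t : unitInterval, L * (t : ℝ) ∈ Set.Icc 0 L := fun t =>
    ⟨mul_nonneg hL.le t.2.1, by nlinarith [t.2.2]⟩
  refine ⟨⟨fun t => f (L * t), hc.comp_continuous (by fun_prop) hmem⟩, ?_, by simp, by simp, ?_⟩
  · intro s t h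
    exact Subtype.ext (mul_left_cancel₀ hL.ne' (hi (hmem s) (hmem t) h))
  · ext v
    constructor
    · rintro ⟨t, rfl⟩
      exact ⟨_, hmem t, rfl⟩
    · rintro ⟨s, hs, rfl⟩
      refine ⟨⟨s / L, div_nonneg hs.1 hL.le, (div_le_one hL).2 hs.2⟩, ?_⟩
      simp [mul_div_cancel₀ s hL.ne']

section RTree

variable {X : Type*} [MetricSpace X]

theorem IsGeodesicOn.continuousOn {γ : ℝ → X} {L : ℝ} (h : IsGeodesicOn γ L) :
    ContinuousOn γ (Set.Icc 0 L) := by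
  refine LipschitzOnWith.continuousOn (K := 1) (LipschitzOnWith.of_dist_le_mul ?_)
  intro s hs t ht
  simp [h s hs t ht, Real.dist_eq]

theorem IsGeodesicOn.injOn {γ : ℝ → X} {L : ℝ} (h : IsGeodesicOn γ L) :
    Set.InjOn γ (Set.Icc 0 L) := by
  intro s hs t ht hst
  have := h s hs t ht
  rw [hst, dist_self] at this
  exact sub_eq_zero.1 (abs_eq_zero.1 this.symm)

theorem IsRTree.exists_geodesic (hX : IsRTree X) (x y : X) :
    ∃ γ : ℝ → X, γ 0 = x ∧ γ (dist x y) = y ∧ IsGeodesicOn γ (dist x y) := by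
  by_cases h : x = y
  · subst h
    refine ⟨fun _ => x, rfl, rfl, ?_⟩
    intro s hs t ht
    rw [dist_self, Set.Icc_self, Set.mem_singleton_iff] at hs ht
    simp [hs, ht]
  · obtain ⟨⟨A, hA, -⟩, hgeo⟩ := hX x y h
    obtain ⟨γ, h0, h1, -, hγ⟩ := hgeo A hA
    exact ⟨γ, h0, h1, hγ⟩

/-- Concatenating two geodesics that only meet at the common endpoint gives a geodesic. -/
theorem IsRTree.dist_eq_add (hX : IsRTree X) {γ₁ γ₂ : ℝ → X} {a b : ℝ}
    (ha : 0 ≤ a) (hb : 0 ≤ b) (h₁ : IsGeodesicOn γ₁ a) (h₂ : IsGeodesicOn γ₂ b)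
    (hab : γ₁ a = γ₂ 0)
    (hinter : ∀ s ∈ Set.Icc 0 a, ∀ t ∈ Set.Icc 0 b, γ₁ s = γ₂ t → t = 0) :
    dist (γ₁ 0) (γ₂ b) = a + b := by
  rcases ha.eq_or_lt with rfl | ha'
  · rw [hab, h₂ 0 ⟨le_rfl, hb⟩ b ⟨hb, le_rfl⟩]
    simp [abs_of_nonneg hb]
  rcases hb.eq_or_lt with rfl | hb'
  · rw [← hab, h₁ 0 ⟨le_rfl, ha⟩ a ⟨ha, le_rfl⟩]
    simp [abs_of_nonneg ha]
  set F : ℝ → X := fun t => if t ≤ a then γ₁ t else γ₂ (t - a) with hF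
  have hF₁ : ∀ t, t ≤ a → F t = γ₁ t := fun t ht => if_pos ht
  have hF₂ : ∀ t, a ≤ t → F t = γ₂ (t - a) := by
    intro t ht
    rcases ht.eq_or_lt with rfl | ht
    · rw [hF₁ _ le_rfl, hab, sub_self]
    · exact if_neg ht.not_ge
  have hcont : ContinuousOn F (Set.Icc 0 (a + b)) := by
    rw [← Set.Icc_union_Icc_eq_Icc ha (by linarith : a ≤ a + b)]
    refine ContinuousOn.union_of_isClosed ?_ ?_ isClosed_Icc isClosed_Icc
    · exact h₁.continuousOn.congr fun t ht => hF₁ t ht.2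
    · have : ContinuousOn (fun t => γ₂ (t - a)) (Set.Icc a (a + b)) := by
        refine h₂.continuousOn.comp (by fun_prop) fun t ht => ?_
        exact ⟨by linarith [ht.1], by linarith [ht.2]⟩
      exact this.congr fun t ht => hF₂ t ht.1
  have hinj : Set.InjOn F (Set.Icc 0 (a + b)) := by
    have key : ∀ s ∈ Set.Icc 0 a, ∀ t ∈ Set.Ioc a (a + b), F s ≠ F t := by
      intro s hs t ht h
      rw [hF₁ s hs.2, hF₂ t ht.1.le] at h
      have := hinter s hs (t - a) ⟨by linarith [ht.1], by linarith [ht.2]⟩ h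
      linarith [ht.1]
    intro s hs t ht h
    rcases le_or_gt s a with hsa | hsa <;> rcases le_or_gt t a with hta | hta
    · rw [hF₁ s hsa, hF₁ t hta] at h
      exact h₁.injOn ⟨hs.1, hsa⟩ ⟨ht.1, hta⟩ h
    · exact (key s ⟨hs.1, hsa⟩ t ⟨hta, ht.2⟩ h).elim
    · exact (key t ⟨ht.1, hta⟩ s ⟨hsa, hs.2⟩ h.symm).elim
    · rw [hF₂ s hsa.le, hF₂ t hta.le] at h
      have := h₂.injOn (x₁ := s - a) (x₂ := t - a) ⟨by linarith, by linarith [hs.2]⟩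
        ⟨by linarith, by linarith [ht.2]⟩ h
      linarith
  have harc := isArcBetween_image (by linarith : 0 < a + b) hcont hinj
  have hne : F 0 ≠ F (a + b) := fun h => by
    have := hinj ⟨le_rfl, by linarith⟩ ⟨by linarith, le_rfl⟩ h
    linarith
  obtain ⟨γ, h0, h1, him, hγ⟩ := (hX _ _ hne).2 _ harc
  have ha_mem : F a ∈ γ '' Set.Icc 0 (dist (F 0) (F (a + b))) := by
    rw [him]
    exact ⟨a, ⟨ha, by linarith⟩, rfl⟩
  obtain ⟨s, hs, hsa⟩ := ha_mem
  have e1 := hγ 0 ⟨le_rfl, dist_nonneg⟩ s hs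
  have e2 := hγ s hs _ ⟨dist_nonneg, le_rfl⟩
  rw [h0, hsa, hF₁ 0 ha, hF₁ a le_rfl, h₁ 0 ⟨le_rfl, ha⟩ a ⟨ha, le_rfl⟩, zero_sub, abs_neg,
    abs_of_nonneg ha, zero_sub, abs_neg, abs_of_nonneg hs.1] at e1
  rw [h1, hsa, hF₁ a le_rfl, hab, hF₂ (a + b) (by linarith), hF₁ 0 ha, add_sub_cancel_left,
    h₂ 0 ⟨le_rfl, hb⟩ b ⟨hb, le_rfl⟩, zero_sub, abs_neg, abs_of_nonneg hb, abs_sub_comm,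
    abs_of_nonneg] at e2
  · linarith
  · have := hs.2
    rw [hF₂ (a + b) (by linarith), hF₁ 0 ha, add_sub_cancel_left] at this
    linarith

/-- Every point of an `ℝ`-tree has a gate in every geodesic segment. -/
theorem IsRTree.exists_gate (hX : IsRTree X) {γ : ℝ → X} {L : ℝ} (hL : 0 ≤ L)
    (hγ : IsGeodesicOn γ L) (z : X) :
    ∃ p ∈ Set.Icc 0 L, ∀ t ∈ Set.Icc 0 L, dist z (γ t) = dist z (γ p) + |p - t| := by
  obtain ⟨p, hp, hmin⟩ := isCompact_Icc.exists_isMinOn (Set.nonempty_Icc.2 hL)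
    ((by fun_prop : Continuous fun v => dist z v).comp_continuousOn hγ.continuousOn)
  refine ⟨p, hp, fun t ht => ?_⟩
  obtain ⟨γ₁, h0, h1, h₁⟩ := hX.exists_geodesic z (γ p)
  have hmeet : ∀ s ∈ Set.Icc 0 (dist z (γ p)), ∀ q ∈ Set.Icc 0 L, γ₁ s = γ q → q = p := by
    intro s hs q hq h
    have e1 := h₁ 0 ⟨le_rfl, dist_nonneg⟩ s hs
    rw [h0, h, zero_sub, abs_neg, abs_of_nonneg hs.1] at e1
    have e2 : dist z (γ p) ≤ dist z (γ q) := hmin hq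
    have e3 : s = dist z (γ p) := le_antisymm hs.2 (by linarith)
    refine hγ.injOn hq hp ?_
    rw [← h, e3, h1]
  rcases le_total p t with hpt | hpt
  · have := hX.dist_eq_add (γ₂ := fun τ => γ (p + τ)) (b := t - p) dist_nonneg (by linarith) h₁
      (fun s hs q hq => by
        rw [hγ _ ⟨by linarith [hp.1, hs.1], by linarith [ht.2, hs.2]⟩ _
          ⟨by linarith [hp.1, hq.1], by linarith [ht.2, hq.2]⟩]
        congr 1; ring) (by simpa using h1)
      (fun s hs q hq h => by
        have := hmeet s hs (p + q) ⟨by linarith [hp.1, hq.1], by linarith [ht.2, hq.2]⟩ h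
        linarith)
    rw [abs_sub_comm, abs_of_nonneg (by linarith : 0 ≤ t - p), ← this, h0]
    simp
  · have := hX.dist_eq_add (γ₂ := fun τ => γ (p - τ)) (b := p - t) dist_nonneg (by linarith) h₁
      (fun s hs q hq => by
        rw [hγ _ ⟨by linarith [ht.1, hs.2], by linarith [hp.2, hs.1]⟩ _
          ⟨by linarith [ht.1, hq.2], by linarith [hp.2, hq.1]⟩, ← abs_neg]
        congr 1; ring) (by simpa using h1)
      (fun s hs q hq h => by
        have := hmeet s hs (p - q) ⟨by linarith [ht.1, hq.2], by linarith [hp.2, hq.1]⟩ h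
        linarith)
    rw [abs_of_nonneg (by linarith : 0 ≤ p - t), ← this, h0]
    simp

theorem IsRTree.fourPoint (hX : IsRTree X) : FourPoint X := by
  intro x y z w
  obtain ⟨γ, h0, h1, hγ⟩ := hX.exists_geodesic x y
  have hD : 0 ≤ dist x y := dist_nonneg
  obtain ⟨p, hp, hz⟩ := hX.exists_gate hD hγ z
  obtain ⟨q, hq, hw⟩ := hX.exists_gate hD hγ w
  have zx := hz 0 ⟨le_rfl, hD⟩
  have zy := hz _ ⟨hD, le_rfl⟩
  have wx := hw 0 ⟨le_rfl, hD⟩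
  have wy := hw _ ⟨hD, le_rfl⟩
  rw [h0, sub_zero, abs_of_nonneg hp.1, dist_comm] at zx
  rw [h0, sub_zero, abs_of_nonneg hq.1, dist_comm] at wx
  rw [h1, abs_sub_comm, abs_of_nonneg (by linarith [hp.2]), dist_comm] at zy
  rw [h1, abs_sub_comm, abs_of_nonneg (by linarith [hq.2]), dist_comm] at wy
  have zw : dist z w ≤ dist z (γ p) + |p - q| + dist w (γ q) := by
    rw [← hγ p hp q hq, dist_comm w]
    exact dist_triangle4 _ _ _ _
  rw [le_max_iff]
  rcases le_total p q with h | h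
  · rw [abs_sub_comm, abs_of_nonneg (by linarith)] at zw
    right; linarith
  · rw [abs_of_nonneg (by linarith)] at zw
    left; linarith

theorem IsRTree.exists_dist_eq (hX : IsRTree X) (x y : X) {t : ℝ} (h0 : 0 ≤ t)
    (ht : t ≤ dist x y) : ∃ v, dist x v = t ∧ dist v y = dist x y - t := by
  obtain ⟨γ, hx, hy, hγ⟩ := hX.exists_geodesic x y
  refine ⟨γ t, ?_, ?_⟩
  · have := hγ 0 ⟨le_rfl, dist_nonneg⟩ t ⟨h0, ht⟩
    rwa [hx, zero_sub, abs_neg, abs_of_nonneg h0] at this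
  · have := hγ t ⟨h0, ht⟩ _ ⟨dist_nonneg, le_rfl⟩
    rwa [hy, abs_sub_comm, abs_of_nonneg (by linarith)] at this

theorem IsRTree.exists_arc (hX : IsRTree X) {x y : X} (hxy : x ≠ y) :
    ∃ A ⊆ metricInterval x y, IsArcBetween x y A := by
  obtain ⟨⟨A, hA, -⟩, hgeo⟩ := hX x y hxy
  obtain ⟨γ, h0, h1, him, hγ⟩ := hgeo A hA
  refine ⟨A, ?_, hA⟩
  rw [← him]
  rintro - ⟨t, ht, rfl⟩
  have e1 := hγ 0 ⟨le_rfl, dist_nonneg⟩ t ht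
  have e2 := hγ t ht _ ⟨dist_nonneg, le_rfl⟩
  rw [h0, zero_sub, abs_neg, abs_of_nonneg ht.1] at e1
  rw [h1, abs_sub_comm, abs_of_nonneg (by linarith [ht.2])] at e2
  change _ + _ = _
  rw [e1, e2]
  ring

theorem IsArcBetween.ofReal_dist_le_diam {x y : X} {A : Set X} (h : IsArcBetween x y A) :
    ENNReal.ofReal (dist x y) ≤ Metric.ediam A := by
  obtain ⟨γ, -, rfl, rfl, rfl⟩ := h
  rw [← edist_dist]
  exact Metric.edist_le_ediam_of_mem ⟨0, rfl⟩ ⟨1, rfl⟩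

theorem IsArcBetween.left_mem {x y : X} {A : Set X} (h : IsArcBetween x y A) : x ∈ A := by
  obtain ⟨γ, -, rfl, rfl, rfl⟩ := h
  exact ⟨0, rfl⟩

end RTree

section Length

variable {X : Type*} [MetricSpace X]

/-- `T` contains finite families of disjoint arcs of total length arbitrarily close to `ℓ`. -/
def LengthGE (T : Set X) (ℓ : ℝ) : Prop :=
  ∀ ε > 0, ∃ S : Finset (Set X), (∀ A ∈ S, A ⊆ T ∧ ∃ x y : X, x ≠ y ∧ IsArcBetween x y A) ∧
    (S : Set (Set X)).Pairwise Disjoint ∧ ENNReal.ofReal (ℓ - ε) ≤ ∑ A ∈ S, Metric.ediam A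

theorem LengthGE.le {T : Set X} {ℓ L : ℝ} (hL : 0 ≤ L) (hlen : treeLength X ≤ ENNReal.ofReal L)
    (h : LengthGE T ℓ) : ℓ ≤ L := by
  refine le_of_forall_pos_sub_le fun ε hε => ?_
  obtain ⟨S, hS, hdis, hsum⟩ := h ε hε
  refine (ENNReal.ofReal_le_ofReal_iff hL).1 (hsum.trans (le_trans ?_ hlen))
  exact le_iSup₂_of_le (f := fun (S : Finset (Set X)) _ => ∑ A ∈ S, Metric.ediam A) S
    ⟨fun A hA => (hS A hA).2, hdis⟩ le_rfl

theorem lengthGE_zero (T : Set X) : LengthGE T 0 := fun ε hε =>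
  ⟨∅, by simp, by simp, by simpa using hε.le⟩

theorem metricInterval_trans {g v u w : X} (hv : v ∈ metricInterval g u)
    (hw : w ∈ metricInterval v u) :
    w ∈ metricInterval g u ∧ dist g v ≤ dist g w := by
  change _ + _ = _ at hv hw
  have h1 := dist_triangle g w u
  have h2 := dist_triangle g v w
  have h3 := dist_triangle v w u
  have h4 := dist_triangle v w g
  refine ⟨?_, ?_⟩
  · change _ + _ = _
    linarith
  · linarith [dist_nonneg (x := v) (y := w)]

/-- Attaching to `T` a segment that meets `T` at most in its starting point increases the length
by the length of the segment. -/
theorem LengthGE.union_metricInterval (hX : IsRTree X) {T : Set X} {ℓ : ℝ} (h : LengthGE T ℓ)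
    {g u : X} (hgu : ∀ v ∈ metricInterval g u, v ∈ T → v = g) :
    LengthGE (T ∪ metricInterval g u) (ℓ + dist g u) := by
  classical
  intro ε hε
  obtain ⟨S, hS, hdis, hsum⟩ := h (ε / 2) (by positivity)
  rcases le_or_gt (dist g u) (ε / 2) with hd | hd
  · exact ⟨S, fun A hA => ⟨(hS A hA).1.trans Set.subset_union_left, (hS A hA).2⟩, hdis,
      le_trans (ENNReal.ofReal_le_ofReal (by linarith)) hsum⟩
  obtain ⟨v, hv1, hv2⟩ := hX.exists_dist_eq g u (by positivity : 0 ≤ ε / 2) hd.le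
  have hvu : v ≠ u := fun h => by
    rw [h, dist_self] at hv2
    linarith
  have hv : v ∈ metricInterval g u := by
    change _ + _ = _
    linarith
  obtain ⟨A, hAsub, hA⟩ := hX.exists_arc hvu
  have hAT : Disjoint A T := by
    rw [Set.disjoint_left]
    intro w hw hwT
    obtain ⟨h1, h2⟩ := metricInterval_trans hv (hAsub hw)
    rw [hgu w h1 hwT, dist_self] at h2
    linarith
  have hAS : A ∉ S := fun hmem =>
    Set.disjoint_left.1 hAT hA.left_mem ((hS A hmem).1 hA.left_mem)
  refine ⟨insert A S, ?_, ?_, ?_⟩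
  · intro B hB
    rcases Finset.mem_insert.1 hB with rfl | hB
    · exact ⟨fun w hw => Or.inr (metricInterval_trans hv (hAsub hw)).1, _, _, hvu, hA⟩
    · exact ⟨(hS B hB).1.trans Set.subset_union_left, (hS B hB).2⟩
  · rw [Finset.coe_insert]
    refine hdis.insert_of_symm fun B hB _ => ?_
    exact hAT.mono_right (hS B hB).1
  · rw [Finset.sum_insert hAS]
    calc ENNReal.ofReal (ℓ + dist g u - ε)
        = ENNReal.ofReal (dist v u + (ℓ - ε / 2)) := by rw [hv2]; congr 1; ring
      _ ≤ ENNReal.ofReal (dist v u) + ENNReal.ofReal (ℓ - ε / 2) := ENNReal.ofReal_add_le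
      _ ≤ _ := add_le_add hA.ofReal_dist_le_diam hsum

theorem lengthGE_metricInterval (hX : IsRTree X) (x y : X) :
    LengthGE (metricInterval x y) (dist x y) := by
  simpa using (lengthGE_zero (∅ : Set X)).union_metricInterval hX (g := x) (u := y) (by simp)

theorem isClosed_metricInterval (x y : X) : IsClosed (metricInterval x y) :=
  isClosed_eq (by fun_prop) (by fun_prop)

/-- A compact set whose length is within `δ` of the maximum is `δ`-dense. -/
theorem LengthGE.add_le (hX : IsRTree X) {L : ℝ} (hL : 0 ≤ L)
    (hlen : treeLength X ≤ ENNReal.ofReal L) {T : Set X} (hT : IsCompact T) (hne : T.Nonempty)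
    {ℓ : ℝ} (h : LengthGE T ℓ) {u : X} {δ : ℝ} (hδ : ∀ t ∈ T, δ ≤ dist u t) : ℓ + δ ≤ L := by
  obtain ⟨g, hg, hmin⟩ := hT.exists_isMinOn hne
    (by fun_prop : Continuous fun t => dist u t).continuousOn
  have hlen' := LengthGE.le hL hlen (h.union_metricInterval hX (g := g) (u := u) ?_)
  · have := hδ g hg
    rw [dist_comm] at this
    linarith
  · intro v hv hvT
    have h1 : dist u g ≤ dist u v := hmin hvT
    change _ + _ = _ at hv
    rw [dist_comm u g, dist_comm u v] at h1
    have : dist g v ≤ 0 := by linarith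
    exact (dist_le_zero.1 this).symm

theorem IsRTree.compactSpace [CompleteSpace X] (hX : IsRTree X) {L : ℝ}
    (hlen : treeLength X ≤ ENNReal.ofReal L) : CompactSpace X := by
  classical
  rw [← isCompact_univ_iff, isCompact_iff_totallyBounded_isComplete]
  refine ⟨?_, isComplete_univ⟩
  rw [Metric.totallyBounded_iff]
  by_contra! hcon
  obtain ⟨ε, hε, hcon⟩ := hcon
  obtain ⟨a, -, ha⟩ := exists_seq_of_forall_finset_exists (fun _ : X => True)
    (fun x y => ε ≤ dist x y) (fun s _ => by
      by_contra! h
      refine hcon s s.finite_toSet fun y _ => ?_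
      obtain ⟨x, hx, hxy⟩ := h y trivial
      exact Set.mem_iUnion₂.2 ⟨x, hx, by rwa [Metric.mem_ball, dist_comm]⟩)
  have ha' : ∀ i j, i ≠ j → ε ≤ dist (a i) (a j) := by
    intro i j hij
    rcases hij.lt_or_gt with h | h
    · exact ha i j h
    · rw [dist_comm]
      exact ha j i h
  have harc : ∀ i, ∃ A : Set X, A ⊆ Metric.closedBall (a i) (ε / 3) ∧
      (∃ x y, x ≠ y ∧ IsArcBetween x y A) ∧ a i ∈ A ∧ ENNReal.ofReal (ε / 3) ≤ Metric.ediam A := by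
    intro i
    obtain ⟨v, hv, -⟩ := hX.exists_dist_eq (a i) (a (i + 1)) (by positivity : 0 ≤ ε / 3)
      (by linarith [ha' i (i + 1) (by simp)])
    have hne : a i ≠ v := fun h => by
      rw [← h, dist_self] at hv
      linarith
    obtain ⟨A, hAsub, hA⟩ := hX.exists_arc hne
    refine ⟨A, ?_, ⟨_, _, hne, hA⟩, hA.left_mem, hv ▸ hA.ofReal_dist_le_diam⟩
    intro w hw
    have : dist (a i) w + dist w v = dist (a i) v := hAsub hw
    rw [Metric.mem_closedBall, dist_comm]
    linarith [dist_nonneg (x := w) (y := v)]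
  choose A hAsub hA hmem hdiam using harc
  have hdisj : ∀ i j, i ≠ j → Disjoint (A i) (A j) := by
    intro i j hij
    refine Set.disjoint_left.2 fun w hwi hwj => ?_
    have h1 := hAsub i hwi
    have h2 := hAsub j hwj
    rw [Metric.mem_closedBall] at h1 h2
    linarith [dist_triangle_left (a i) (a j) w, ha' i j hij]
  have hinj : Function.Injective A := by
    intro i j h
    by_contra hij
    exact Set.disjoint_left.1 (hdisj i j hij) (hmem i) (h ▸ hmem i)
  have hN : ∀ N : ℕ, (N : ℝ≥0∞) * ENNReal.ofReal (ε / 3) ≤ ENNReal.ofReal L := by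
    intro N
    refine le_trans ?_ hlen
    refine le_iSup₂_of_le (f := fun (S : Finset (Set X)) _ => ∑ A ∈ S, Metric.ediam A)
      ((Finset.range N).image A) ⟨?_, ?_⟩ ?_
    · intro B hB
      obtain ⟨i, -, rfl⟩ := Finset.mem_image.1 hB
      exact hA i
    · intro B hB C hC hBC
      obtain ⟨i, -, rfl⟩ := Finset.mem_image.1 hB
      obtain ⟨j, -, rfl⟩ := Finset.mem_image.1 hC
      exact hdisj i j fun h => hBC (h ▸ rfl)
    · rw [Finset.sum_image hinj.injOn]
      calc (N : ℝ≥0∞) * ENNReal.ofReal (ε / 3) = ∑ _i ∈ Finset.range N, ENNReal.ofReal (ε / 3) := by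
            simp
        _ ≤ _ := Finset.sum_le_sum fun i _ => hdiam i
  obtain ⟨N, hN'⟩ := exists_nat_gt (L / (ε / 3))
  have h1 := hN N
  rw [← ENNReal.ofReal_natCast, ← ENNReal.ofReal_mul (by positivity)] at h1
  rw [div_lt_iff₀ (by positivity)] at hN'
  rcases le_or_gt L 0 with hL | hL
  · rw [ENNReal.ofReal_of_nonpos hL] at h1
    have h2 := hN 1
    rw [ENNReal.ofReal_of_nonpos hL, Nat.cast_one, one_mul, nonpos_iff_eq_zero,
      ENNReal.ofReal_eq_zero] at h2
    linarith
  · rw [ENNReal.ofReal_le_ofReal_iff hL.le] at h1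
    linarith

end Length

section FixedPoint

variable {X : Type*} [MetricSpace X]

/-- A betweenness chain with nontrivial middle segment is geodesic. -/
theorem FourPoint.dist_eq_of_between (h4 : FourPoint X) {a b c d : X} (hbc : b ≠ c)
    (h₁ : dist a c = dist a b + dist b c) (h₂ : dist b d = dist b c + dist c d) :
    dist a d = dist a b + dist b d := by
  have h := h4 a c b d
  have hpos := dist_pos.2 hbc
  rw [dist_comm c b] at h
  have := dist_triangle a b d
  rcases le_max_iff.1 h with h | h <;> linarith

/-- A fixed-point theorem for closed relations on compact trees: some point lies
between two of its images. -/
theorem exists_between_of_isClosed [CompactSpace X] [Nonempty X] (h4 : FourPoint X)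
    (hgeo : ∀ x y : X, ∀ t : ℝ, 0 ≤ t → t ≤ dist x y →
      ∃ v, dist x v = t ∧ dist v y = dist x y - t)
    {r : X → X → Prop} (hr : IsClosed {p : X × X | r p.1 p.2}) (htot : ∀ x, ∃ y, r x y) :
    ∃ p q q', r p q ∧ r p q' ∧ dist q q' = dist q p + dist p q' := by
  by_contra! hcon
  let K : Set ((X × X) × (X × X)) := {z | r z.1.1 z.1.2 ∧ r z.2.1 z.2.2}
  let f : (X × X) × (X × X) → ℝ := fun z =>
    max (dist z.1.1 z.2.1) (dist z.1.1 z.1.2 + dist z.1.1 z.2.2 - dist z.1.2 z.2.2)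
  have hK : IsCompact K :=
    ((hr.preimage continuous_fst).inter (hr.preimage continuous_snd)).isCompact
  choose φ hφ using htot
  have hKne : K.Nonempty := by
    obtain ⟨x⟩ := ‹Nonempty X›
    exact ⟨((x, φ x), (x, φ x)), hφ x, hφ x⟩
  obtain ⟨z₀, hz₀, hmin⟩ := hK.exists_isMinOn hKne
    (by fun_prop : Continuous f).continuousOn
  have hpos : 0 < f z₀ := by
    by_contra! hle
    obtain ⟨⟨p, q⟩, ⟨p', q'⟩⟩ := z₀
    obtain ⟨h1, h2⟩ := max_le_iff.1 hle
    obtain rfl : p = p' := dist_le_zero.1 h1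
    refine hcon p q q' hz₀.1 hz₀.2 (le_antisymm (dist_triangle _ _ _) ?_)
    simp only at h2
    rw [dist_comm q p]
    linarith
  set η := f z₀ / 4 with hη
  have hη0 : 0 < η := by positivity
  have key : ∀ p q p' q', r p q → r p' q' → dist p p' ≤ η →
      4 * η ≤ dist p q + dist p q' - dist q q' := by
    intro p q p' q' h h' hd
    have h1 : f z₀ ≤ f ((p, q), (p', q')) := hmin ⟨h, h'⟩
    rcases le_max_iff.1 h1 with h1 | h1
    · simp only at h1
      linarith
    · simp only at h1
      linarith
  have hfar : ∀ p, η ≤ dist p (φ p) := fun p => by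
    have := key p (φ p) p (φ p) (hφ p) (hφ p) (by simpa using hη0.le)
    rw [dist_self] at this
    linarith
  choose step hstep₁ hstep₂ using fun p => hgeo p (φ p) η hη0.le (hfar p)
  have hlocal : ∀ p, dist p (step (step p)) = dist p (step p) + dist (step p) (step (step p)) := by
    intro p
    have hk := key p (φ p) (step p) (φ (step p)) (hφ _) (hφ _) (hstep₁ p).le
    have h1 := hstep₁ p
    have h2 := hstep₂ p
    have h3 := hstep₁ (step p)
    have h4' := hstep₂ (step p)
    have hb : dist p (φ (step p)) = dist p (step p) + dist (step p) (φ (step p)) := by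
      have := h4 p (φ p) (step p) (φ (step p))
      have t1 := dist_triangle p (step p) (φ (step p))
      rw [dist_comm (φ p) (step p)] at this
      rcases le_max_iff.1 this with h | h <;> linarith
    have t1 := dist_triangle p (step (step p)) (φ (step p))
    have t2 := dist_triangle p (step p) (step (step p))
    linarith
  obtain ⟨x⟩ := ‹Nonempty X›
  have hchain : ∀ n : ℕ, dist x (step^[n] x) = n * η ∧
      dist x (step^[n + 1] x) = dist x (step^[n] x) + η := by
    intro n
    induction n with
    | zero => simp [hstep₁]
    | succ n ih =>
      obtain ⟨ih1, ih2⟩ := ih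
      refine ⟨by rw [ih2, ih1]; push_cast; ring, ?_⟩
      have e1 : step^[n + 1] x = step (step^[n] x) := Function.iterate_succ_apply' _ _ _
      have e2 : step^[n + 1 + 1] x = step (step (step^[n] x)) := by
        rw [Function.iterate_succ_apply', e1]
      rw [e1] at ih2 ⊢
      rw [e2]
      have hne : step^[n] x ≠ step (step^[n] x) := fun h => by
        have := hstep₁ (step^[n] x)
        rw [← h, dist_self] at this
        linarith
      have := h4.dist_eq_of_between (a := x) hne (by rw [ih2, hstep₁]) (hlocal _)
      rw [this, hlocal, hstep₁, hstep₁, ih2]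
      ring
  obtain ⟨n, hn⟩ := exists_nat_gt (Metric.diam (Set.univ : Set X) / η)
  rw [div_lt_iff₀ hη0] at hn
  have := (hchain n).1
  have := Metric.dist_le_diam_of_mem Metric.isBounded_of_compactSpace (Set.mem_univ x)
    (Set.mem_univ (step^[n] x))
  linarith

end FixedPoint

section Coordinates

variable {X : Type*} [MetricSpace X]

/-- Position, relative to the midpoint, of the projection of `u` to the segment from `a` to `b`. -/
def segPos (a b u : X) : ℝ := (dist a u - dist u b) / 2

/-- Distance from `u` to the segment from `a` to `b` of a tree. -/
def segHeight (a b u : X) : ℝ := (dist a u + dist u b - dist a b) / 2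

theorem dist_left_eq (a b u : X) :
    dist a u = dist a b / 2 + segPos a b u + segHeight a b u := by
  unfold segPos segHeight; ring

theorem dist_right_eq (a b u : X) :
    dist u b = dist a b / 2 - segPos a b u + segHeight a b u := by
  unfold segPos segHeight; ring

theorem segPos_swap (a b u : X) : segPos b a u = -segPos a b u := by
  simp only [segPos, dist_comm b u, dist_comm u a]; ring

theorem segHeight_swap (a b u : X) : segHeight b a u = segHeight a b u := by
  simp only [segHeight, dist_comm b u, dist_comm u a, dist_comm b a]; ring

theorem segHeight_nonneg (a b u : X) : 0 ≤ segHeight a b u := by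
  unfold segHeight
  linarith [dist_triangle a u b]

theorem segHeight_eq_zero {a b u : X} : segHeight a b u = 0 ↔ u ∈ metricInterval a b := by
  change _ ↔ _ = _
  unfold segHeight
  constructor <;> intro h <;> linarith

theorem segPos_le (a b u : X) : segPos a b u ≤ dist a b / 2 := by
  unfold segPos
  linarith [dist_triangle a b u, dist_comm b u]

theorem neg_le_segPos (a b u : X) : -(dist a b / 2) ≤ segPos a b u := by
  unfold segPos
  linarith [dist_triangle u a b, dist_comm u a]

theorem segHeight_le_add (a b u v : X) : segHeight a b u ≤ segHeight a b v + dist u v := by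
  unfold segHeight
  linarith [dist_triangle a v u, dist_triangle u v b, dist_comm u v]

theorem FourPoint.dist_le (h4 : FourPoint X) (a b u v : X) :
    dist u v ≤ |segPos a b u - segPos a b v| + segHeight a b u + segHeight a b v := by
  have h := h4 a b u v
  rw [dist_comm b v, dist_comm b u, dist_left_eq a b u, dist_left_eq a b v, dist_right_eq a b u,
    dist_right_eq a b v] at h
  have h1 := le_abs_self (segPos a b u - segPos a b v)
  have h2 := neg_abs_le (segPos a b u - segPos a b v)
  rcases le_max_iff.1 h with h | h <;> linarith

theorem FourPoint.dist_eq_of_lt (h4 : FourPoint X) {a b u v : X}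
    (huv : segPos a b u < segPos a b v) :
    dist u v = segPos a b v - segPos a b u + segHeight a b u + segHeight a b v := by
  refine le_antisymm ?_ ?_
  · have := h4.dist_le a b u v
    rwa [abs_sub_comm, abs_of_pos (by linarith)] at this
  · have h := h4 a v b u
    rw [dist_comm b u, dist_comm v u, dist_left_eq a b u, dist_left_eq a b v, dist_right_eq a b u,
      dist_comm v b, dist_comm b v, dist_right_eq a b v] at h
    rcases le_max_iff.1 h with h | h <;> linarith

theorem FourPoint.dist_eq_of_ne (h4 : FourPoint X) {a b u v : X}
    (huv : segPos a b u ≠ segPos a b v) :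
    dist u v = |segPos a b u - segPos a b v| + segHeight a b u + segHeight a b v := by
  rcases huv.lt_or_gt with h | h
  · rw [h4.dist_eq_of_lt h, abs_of_neg (by linarith)]
    ring
  · rw [dist_comm, h4.dist_eq_of_lt h, abs_of_pos (by linarith)]
    ring

/-- The segment joining a point to its projection. -/
theorem IsRTree.exists_hair (hX : IsRTree X) (a b x : X) :
    ∃ g ∈ metricInterval a b, segPos a b g = segPos a b x ∧ dist g x = segHeight a b x ∧
      ∀ v ∈ metricInterval g x, segPos a b v = segPos a b x ∧ dist g v = segHeight a b v ∧
        dist v x = segHeight a b x - segHeight a b v := by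
  obtain ⟨g, hg1, hg2⟩ := hX.exists_dist_eq a b (t := dist a b / 2 + segPos a b x)
    (by linarith [neg_le_segPos a b x]) (by linarith [segPos_le a b x])
  have hpos : segPos a b g = segPos a b x := by
    rw [segPos, hg1, hg2]; ring
  have hh : segHeight a b g = 0 := by
    rw [segHeight, hg1, hg2]; ring
  have hgx : dist g x = segHeight a b x := by
    refine le_antisymm ?_ ?_
    · have := hX.fourPoint.dist_le a b g x
      rwa [hpos, sub_self, abs_zero, hh, zero_add, zero_add] at this
    · have := segHeight_le_add a b x g
      rwa [hh, zero_add, dist_comm] at this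
  refine ⟨g, segHeight_eq_zero.1 hh, hpos, hgx, fun v hv => ?_⟩
  change _ + _ = _ at hv
  have h1 := segHeight_le_add a b v g
  have h2 := segHeight_le_add a b x v
  rw [dist_comm] at h1 h2
  have h3 := dist_triangle a g v
  have h4 := dist_triangle v g b
  rw [dist_comm v g] at h4
  have h5 := dist_left_eq a b v
  have h6 := dist_right_eq a b v
  refine ⟨?_, ?_, ?_⟩ <;> linarith

theorem IsRTree.lengthGE_hair (hX : IsRTree X) (a b x : X) :
    ∃ g ∈ metricInterval a b, segPos a b g = segPos a b x ∧ dist g x = segHeight a b x ∧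
      (∀ v ∈ metricInterval g x, segPos a b v = segPos a b x ∧ dist g v = segHeight a b v ∧
        dist v x = segHeight a b x - segHeight a b v) ∧
      LengthGE (metricInterval a b ∪ metricInterval g x) (dist a b + segHeight a b x) := by
  obtain ⟨g, hg, hpos, hgx, hv⟩ := hX.exists_hair a b x
  refine ⟨g, hg, hpos, hgx, hv, ?_⟩
  rw [← hgx]
  refine (lengthGE_metricInterval hX a b).union_metricInterval hX fun v hvx hvab => ?_
  have := (hv v hvx).2.1
  rw [segHeight_eq_zero.2 hvab] at this
  exact (dist_eq_zero.1 this).symm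

/-- Length bound for a segment with hairs ending at `x` and `z`, and a further point `u`. -/
theorem IsRTree.dist_add_segHeight_add_le [CompactSpace X] (hX : IsRTree X) {L : ℝ} (hL : 0 ≤ L)
    (hlen : treeLength X ≤ ENNReal.ofReal L) {a b x z u : X} {δ : ℝ}
    (hxz : segPos a b x ≠ segPos a b z) (hu : δ ≤ segHeight a b u)
    (hux : ∀ t, segPos a b t = segPos a b x → dist t x = segHeight a b x - segHeight a b t →
      δ ≤ dist u t)
    (huz : ∀ t, segPos a b t = segPos a b z → dist t z = segHeight a b z - segHeight a b t →
      δ ≤ dist u t) :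
    dist a b + segHeight a b x + segHeight a b z + δ ≤ L := by
  obtain ⟨g, hg, hpos, hgx, hv, hlen₁⟩ := hX.lengthGE_hair a b x
  obtain ⟨g', hg', hpos', hgz, hv'⟩ := hX.exists_hair a b z
  have hlen₂ := hlen₁.union_metricInterval hX (g := g') (u := z) (by
    rintro v hvz (hvab | hvx)
    · have := (hv' v hvz).2.1
      rw [segHeight_eq_zero.2 hvab] at this
      exact (dist_eq_zero.1 this).symm
    · exact (hxz ((hv v hvx).1.symm.trans (hv' v hvz).1)).elim)
  rw [hgz] at hlen₂
  refine hlen₂.add_le hX hL hlen ?_ ⟨g, Or.inl (Or.inl hg)⟩ (u := u) ?_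
  · exact (((isClosed_metricInterval _ _).union (isClosed_metricInterval _ _)).union
      (isClosed_metricInterval _ _)).isCompact
  · rintro t ((ht | ht) | ht)
    · have := segHeight_le_add a b u t
      rw [segHeight_eq_zero.2 ht] at this
      linarith
    · exact hux t (hv t ht).1 (hv t ht).2.2
    · exact huz t (hv' t ht).1 (hv' t ht).2.2

theorem IsRTree.two_hairs_le [CompactSpace X] (hX : IsRTree X) {L : ℝ} (hL : 0 ≤ L)
    (hlen : treeLength X ≤ ENNReal.ofReal L) {a b x z : X}
    (hxz : segPos a b x ≠ segPos a b z) :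
    dist a b + segHeight a b x + segHeight a b z ≤ L := by
  have := hX.dist_add_segHeight_add_le hL hlen (u := x) (δ := 0) hxz (segHeight_nonneg _ _ _)
    (fun _ _ _ => dist_nonneg) (fun _ _ _ => dist_nonneg)
  linarith

theorem IsRTree.three_hairs_le [CompactSpace X] (hX : IsRTree X) {L : ℝ} (hL : 0 ≤ L)
    (hlen : treeLength X ≤ ENNReal.ofReal L) {a b x z u : X}
    (hxz : segPos a b x ≠ segPos a b z) (hux : segPos a b u ≠ segPos a b x)
    (huz : segPos a b u ≠ segPos a b z) :
    dist a b + segHeight a b x + segHeight a b z + segHeight a b u ≤ L := by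
  have key : ∀ t, segPos a b u ≠ segPos a b t → segHeight a b u ≤ dist u t := fun t ht => by
    rw [hX.fourPoint.dist_eq_of_ne ht]
    linarith [abs_nonneg (segPos a b u - segPos a b t), segHeight_nonneg a b t]
  exact hX.dist_add_segHeight_add_le hL hlen hxz le_rfl
    (fun t ht _ => key t (ht ▸ hux)) (fun t ht _ => key t (ht ▸ huz))

theorem IsRTree.branched_hair_le [CompactSpace X] (hX : IsRTree X) {L : ℝ} (hL : 0 ≤ L)
    (hlen : treeLength X ≤ ENNReal.ofReal L) {a b x z u : X}
    (hxz : segPos a b x ≠ segPos a b z) (hux : segPos a b u = segPos a b x) :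
    dist a b + segHeight a b z +
      (segHeight a b x + segHeight a b u + dist u x) / 2 ≤ L := by
  have hle := hX.fourPoint.dist_le a b u x
  rw [hux, sub_self, abs_zero] at hle
  have := hX.dist_add_segHeight_add_le hL hlen (u := u)
    (δ := (segHeight a b u + dist u x - segHeight a b x) / 2) hxz (by linarith)
    (fun t _ ht => by
      have := segHeight_le_add a b u t
      have := dist_triangle u t x
      linarith)
    (fun t ht _ => by
      rw [hX.fourPoint.dist_eq_of_ne (a := a) (b := b) (u := u) (v := t)
        (by rw [hux, ht]; exact hxz)]
      linarith [abs_nonneg (segPos a b u - segPos a b t), segHeight_nonneg a b t])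
  linarith

end Coordinates

section Correspondence

variable {X Y : Type*} [MetricSpace X] [MetricSpace Y]

theorem abs_sub_lt_of_distortion_lt {R : Set (X × Y)} {a : ℝ}
    (h : distortion R < ENNReal.ofReal a) {p q : X × Y} (hp : p ∈ R) (hq : q ∈ R) :
    |dist p.1 q.1 - dist p.2 q.2| < a := by
  have : ENNReal.ofReal |dist p.1 q.1 - dist p.2 q.2| ≤ distortion R :=
    le_iSup₂_of_le (f := fun p q : R =>
      ENNReal.ofReal |dist (p : X × Y).1 (q : X × Y).1 - dist (p : X × Y).2 (q : X × Y).2|)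
      ⟨p, hp⟩ ⟨q, hq⟩ le_rfl
  exact (ENNReal.ofReal_lt_ofReal_iff_of_nonneg (abs_nonneg _)).1 (this.trans_lt h)

/-- Between compact spaces the Gromov–Hausdorff distance is realized by a closed correspondence. -/
theorem exists_isClosed_isCorrespondence [CompactSpace X] [CompactSpace Y] {a : ℝ} (ha : 0 ≤ a)
    (h : ghDist X Y = ENNReal.ofReal a) :
    ∃ R : Set (X × Y), IsCorrespondence R ∧ IsClosed R ∧
      ∀ p ∈ R, ∀ q ∈ R, |dist p.1 q.1 - dist p.2 q.2| ≤ 2 * a := by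
  have hinf : (⨅ R : {R : Set (X × Y) // IsCorrespondence R}, distortion (R : Set (X × Y)))
      = ENNReal.ofReal (2 * a) := by
    rw [ghDist, eq_comm, ENNReal.eq_div_iff (by simp) (by simp)] at h
    rw [← h, ENNReal.ofReal_mul (by simp)]
    simp
  have hex : ∀ n : ℕ, ∃ R : Set (X × Y), IsCorrespondence R ∧
      ∀ p ∈ R, ∀ q ∈ R, |dist p.1 q.1 - dist p.2 q.2| < 2 * a + 1 / ((n : ℝ) + 1) := by
    intro n
    have hn : (0 : ℝ) < 1 / ((n : ℝ) + 1) := by positivity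
    have : (⨅ R : {R : Set (X × Y) // IsCorrespondence R}, distortion (R : Set (X × Y)))
        < ENNReal.ofReal (2 * a + 1 / ((n : ℝ) + 1)) := by
      rw [hinf]
      exact (ENNReal.ofReal_lt_ofReal_iff (by positivity)).2 (by linarith)
    obtain ⟨⟨R, hR⟩, hlt⟩ := iInf_lt_iff.1 this
    exact ⟨R, hR, fun p hp q hq => abs_sub_lt_of_distortion_lt hlt hp hq⟩
  choose R hR hdis using hex
  let F : Ultrafilter ℕ := Filter.hyperfilter ℕ
  have hF : (F : Filter ℕ) ≤ Filter.atTop := Nat.hyperfilter_le_atTop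
  let R' : Set (X × Y) := {p | ∃ u : ℕ → X × Y, (∀ n, u n ∈ R n) ∧ Filter.Tendsto u F (nhds p)}
  have hdis' : ∀ p ∈ R', ∀ q ∈ R', |dist p.1 q.1 - dist p.2 q.2| ≤ 2 * a := by
    rintro p ⟨u, hu, hup⟩ q ⟨v, hv, hvq⟩
    have hlim : Filter.Tendsto
        (fun n => |dist (u n).1 (v n).1 - dist (u n).2 (v n).2|) F
        (nhds |dist p.1 q.1 - dist p.2 q.2|) :=
      (((hup.fst_nhds.dist hvq.fst_nhds).sub (hup.snd_nhds.dist hvq.snd_nhds))).abs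
    have hlim' : Filter.Tendsto (fun n : ℕ => 2 * a + 1 / ((n : ℝ) + 1)) F (nhds (2 * a + 0)) :=
      (tendsto_const_nhds.add tendsto_one_div_add_atTop_nhds_zero_nat).mono_left hF
    rw [add_zero] at hlim'
    exact le_of_tendsto_of_tendsto' hlim hlim' fun n => (hdis n _ (hu n) _ (hv n)).le
  have hcorr : ∀ u : ℕ → X × Y, (∀ n, u n ∈ R n) → ∃ p ∈ R', Filter.Tendsto u F (nhds p) := by
    intro u hu
    obtain ⟨p, -, hp⟩ := isCompact_univ.ultrafilter_le_nhds (F.map u) (by simp)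
    exact ⟨p, ⟨u, hu, hp⟩, hp⟩
  refine ⟨closure R', ⟨fun x => ?_, fun y => ?_⟩, isClosed_closure, ?_⟩
  · choose y hy using fun n => (hR n).1 x
    obtain ⟨p, hp, hlim⟩ := hcorr (fun n => (x, y n)) hy
    obtain rfl : x = p.1 := tendsto_nhds_unique tendsto_const_nhds hlim.fst_nhds
    exact ⟨p.2, subset_closure hp⟩
  · choose x hx using fun n => (hR n).2 y
    obtain ⟨p, hp, hlim⟩ := hcorr (fun n => (x n, y)) hx
    obtain rfl : y = p.2 := tendsto_nhds_unique tendsto_const_nhds hlim.snd_nhds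
    exact ⟨p.1, subset_closure hp⟩
  · have hclosed : IsClosed {z : (X × Y) × (X × Y) |
        |dist z.1.1 z.2.1 - dist z.1.2 z.2.2| ≤ 2 * a} :=
      isClosed_le (by fun_prop) continuous_const
    have hsub : closure (R' ×ˢ R') ⊆ {z : (X × Y) × (X × Y) |
        |dist z.1.1 z.2.1 - dist z.1.2 z.2.2| ≤ 2 * a} :=
      closure_minimal (fun z hz => hdis' z.1 hz.1 z.2 hz.2) hclosed
    rw [closure_prod_eq] at hsub
    exact fun p hp q hq => hsub (Set.mk_mem_prod hp hq)

end Correspondence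

section CircleRelation

variable {X : Type*} [MetricSpace X]

/-- A closed relation of distortion at most `π / 2` between angles and points of `X`. -/
structure CircleRelation (Q : ℝ → X → Prop) : Prop where
  exists_rel : ∀ θ, ∃ u, Q θ u
  isClosed : IsClosed {p : ℝ × X | Q p.1 p.2}
  add_period : ∀ θ u, Q (θ + 2 * π) u ↔ Q θ u
  abs_sub_le : ∀ θ θ' u u', Q θ u → Q θ' u' →
    |dist u u' - ‖((θ - θ' : ℝ) : AddCircle (2 * π))‖| ≤ π / 2

theorem norm_coe_circle {t : ℝ} (ht : |t| ≤ π) : ‖(t : AddCircle (2 * π))‖ = |t| := by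
  refine (AddCircle.norm_coe_eq_abs_iff _ (by positivity)).2 (ht.trans_eq ?_)
  rw [abs_of_pos (by positivity)]
  ring

variable {Q : ℝ → X → Prop}

theorem CircleRelation.neg (hQ : CircleRelation Q) : CircleRelation fun θ => Q (-θ) where
  exists_rel θ := hQ.exists_rel (-θ)
  isClosed := hQ.isClosed.preimage (f := fun p : ℝ × X => (-p.1, p.2)) (by fun_prop)
  add_period θ u := by
    rw [← hQ.add_period, show -(θ + 2 * π) + 2 * π = -θ by ring]
  abs_sub_le θ θ' u u' h h' := by
    have := hQ.abs_sub_le _ _ u u' h h'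
    rwa [show -θ - -θ' = -(θ - θ') by ring, AddCircle.coe_neg, norm_neg] at this

theorem CircleRelation.dist_near (hQ : CircleRelation Q) {θ θ' : ℝ} {u u' : X} (h : Q θ u)
    (h' : Q θ' u') (h0 : 0 ≤ θ' - θ) (h1 : θ' - θ ≤ π) :
    θ' - θ - π / 2 ≤ dist u u' ∧ dist u u' ≤ θ' - θ + π / 2 := by
  have := abs_le.1 (hQ.abs_sub_le _ _ _ _ h h')
  rw [norm_coe_circle (by rw [abs_sub_comm, abs_of_nonneg h0]; exact h1), abs_sub_comm,
    abs_of_nonneg h0] at this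
  constructor <;> linarith

theorem CircleRelation.dist_far (hQ : CircleRelation Q) {θ θ' : ℝ} {u u' : X} (h : Q θ u)
    (h' : Q θ' u') (h0 : π ≤ θ' - θ) (h1 : θ' - θ ≤ 2 * π) :
    3 * π / 2 - (θ' - θ) ≤ dist u u' ∧ dist u u' ≤ 5 * π / 2 - (θ' - θ) := by
  have := hQ.dist_near h' ((hQ.add_period _ _).2 h) (by linarith) (by linarith)
  rw [dist_comm u' u] at this
  constructor <;> linarith [this.1, this.2]

/-- A circle relation with `m` the midpoint of a segment from `a` to `b` of length `π`, such that
`a`, `b` and `m` correspond to `-π/4`, `π/4` and `±3π/4`. -/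
structure CircleConfiguration (Q : ℝ → X → Prop) (a b m : X) : Prop where
  rel : CircleRelation Q
  left : Q (-(π / 4)) a
  right : Q (π / 4) b
  mid : Q (3 * π / 4) m
  mid' : Q (-(3 * π / 4)) m
  dist_left : dist a m = π / 2
  dist_right : dist m b = π / 2
  dist_ends : dist a b = π

variable {a b m : X}

theorem CircleConfiguration.neg (hC : CircleConfiguration Q a b m) :
    CircleConfiguration (fun θ => Q (-θ)) b a m where
  rel := hC.rel.neg
  left := by simpa using hC.right
  right := hC.left
  mid := hC.mid'
  mid' := by simpa using hC.mid
  dist_left := by rw [dist_comm]; exact hC.dist_right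
  dist_right := by rw [dist_comm]; exact hC.dist_left
  dist_ends := by rw [dist_comm]; exact hC.dist_ends

theorem CircleConfiguration.segPos_mid (hC : CircleConfiguration Q a b m) :
    segPos a b m = 0 := by
  rw [segPos, hC.dist_left, hC.dist_right]; ring

theorem CircleConfiguration.segHeight_mid (hC : CircleConfiguration Q a b m) :
    segHeight a b m = 0 := by
  rw [segHeight, hC.dist_left, hC.dist_right, hC.dist_ends]; ring

theorem CircleConfiguration.dist_left_eq (hC : CircleConfiguration Q a b m) (u : X) :
    dist a u = π / 2 + segPos a b u + segHeight a b u := by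
  rw [_root_.dist_left_eq a b u, hC.dist_ends]

theorem CircleConfiguration.dist_right_eq (hC : CircleConfiguration Q a b m) (u : X) :
    dist u b = π / 2 - segPos a b u + segHeight a b u := by
  rw [_root_.dist_right_eq a b u, hC.dist_ends]

theorem CircleConfiguration.dist_mid_le (hC : CircleConfiguration Q a b m) (h4 : FourPoint X)
    (u : X) : dist u m ≤ |segPos a b u| + segHeight a b u := by
  simpa [hC.segPos_mid, hC.segHeight_mid] using h4.dist_le a b u m

/-- A point over the angle `0` on the right side of the segment. -/
theorem CircleConfiguration.exists_rel_zero_right [CompactSpace X]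
    (hC : CircleConfiguration Q a b m) (h4 : FourPoint X) :
    ∃ x, Q 0 x ∧ 0 ≤ segPos a b x ∧ segPos a b x + segHeight a b x = π / 4 := by
  have hpi := Real.pi_pos
  have key : ∀ θ u, 0 < θ → θ ≤ π / 4 → Q θ u →
      0 ≤ segPos a b u ∧ segPos a b u + segHeight a b u = π / 4 + θ := by
    intro θ u h0 h1 hu
    have e1 := (hC.rel.dist_near hu hC.right (by linarith) (by linarith)).2
    have e2 := (hC.rel.dist_near hC.left hu (by linarith) (by linarith)).2
    have e3 := (hC.rel.dist_near hC.mid' hu (by linarith) (by linarith)).1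
    rw [hC.dist_right_eq] at e1
    rw [hC.dist_left_eq] at e2
    rw [dist_comm] at e3
    have e4 := hC.dist_mid_le h4 u
    rcases le_or_gt 0 (segPos a b u) with hs | hs
    · rw [abs_of_nonneg hs] at e4
      exact ⟨hs, by linarith⟩
    · rw [abs_of_neg hs] at e4
      linarith
  set θ : ℕ → ℝ := fun n => π / 4 * (1 / ((n : ℝ) + 1)) with hθ
  have hθ0 : ∀ n, 0 < θ n := fun n => by positivity
  have hθ1 : ∀ n, θ n ≤ π / 4 := fun n => by
    have : 1 / ((n : ℝ) + 1) ≤ 1 := by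
      rw [div_le_one (by positivity)]
      linarith [Nat.cast_nonneg (α := ℝ) n]
    exact mul_le_of_le_one_right (by positivity) this
  have hθlim : Filter.Tendsto θ Filter.atTop (nhds 0) := by
    have := (tendsto_one_div_add_atTop_nhds_zero_nat (𝕜 := ℝ)).const_mul (π / 4)
    rwa [mul_zero] at this
  choose u hu using fun n => hC.rel.exists_rel (θ n)
  obtain ⟨x, -, φ, hφ, hlim⟩ := isCompact_univ.tendsto_subseq (x := u) fun _ => Set.mem_univ _
  have hθφ := hθlim.comp hφ.tendsto_atTop
  refine ⟨x, ?_, ?_, ?_⟩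
  · exact hC.rel.isClosed.mem_of_tendsto (hθφ.prodMk_nhds hlim)
      (Filter.Eventually.of_forall fun n => hu (φ n))
  · have hc : Continuous (segPos a b) := by
      unfold segPos
      fun_prop
    exact ge_of_tendsto' ((hc.tendsto x).comp hlim)
      fun n => (key _ _ (hθ0 _) (hθ1 _) (hu (φ n))).1
  · have hc : Continuous fun v => segPos a b v + segHeight a b v := by
      unfold segPos segHeight
      fun_prop
    have h1 := (hc.tendsto x).comp hlim
    have h2 : Filter.Tendsto (fun n => π / 4 + θ (φ n)) Filter.atTop (nhds (π / 4 + 0)) :=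
      tendsto_const_nhds.add hθφ
    rw [add_zero] at h2
    refine tendsto_nhds_unique h1 (h2.congr fun n => ?_)
    exact (key _ _ (hθ0 _) (hθ1 _) (hu (φ n))).2.symm

/-- If no hair of length `π / 4` is attached at `m`, the point over `π` cannot project to the
right side of the segment. -/
theorem CircleConfiguration.segPos_nonpos_of_rel_pi [CompactSpace X]
    (hC : CircleConfiguration Q a b m) (hX : IsRTree X)
    (hlen : treeLength X ≤ ENNReal.ofReal (5 * π / 4)) {x x' z : X} (hx : Q 0 x)
    (hx0 : 0 < segPos a b x) (hxh : segPos a b x + segHeight a b x = π / 4) (hx' : Q 0 x')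
    (hx'0 : segPos a b x' < 0) (hx'h : -segPos a b x' + segHeight a b x' = π / 4)
    (hz : Q π z) : segPos a b z ≤ 0 := by
  by_contra! hz0
  have hpi := Real.pi_pos
  have h4 := hX.fourPoint
  have hL : (0 : ℝ) ≤ 5 * π / 4 := by positivity
  have nn := segHeight_nonneg a b
  have hzx := (hC.rel.dist_near hx hz (by linarith) (by linarith)).1
  have hzb := (hC.rel.dist_near hC.right hz (by linarith) (by linarith)).1
  rw [dist_comm b z, hC.dist_right_eq] at hzb
  have hzle := segPos_le a b z
  rw [hC.dist_ends] at hzle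
  have hsne : segPos a b x ≠ segPos a b z := by
    intro h
    have h1 := h4.dist_le a b x z
    have h2 := hX.two_hairs_le hL hlen (a := a) (b := b) (x := z) (z := x') (by linarith)
    rw [h, sub_self, abs_zero] at h1
    rw [hC.dist_ends] at h2
    linarith [nn x']
  have hd := h4.dist_eq_of_ne hsne
  have hxz := hX.two_hairs_le hL hlen hsne
  rw [hC.dist_ends] at hxz
  have hlt : segPos a b x < segPos a b z := by
    by_contra! h
    rw [abs_of_nonneg (by linarith)] at hd
    linarith [nn x]
  rw [abs_of_neg (by linarith)] at hd
  have hzs : segPos a b z = π / 4 + segPos a b x := by linarith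
  have hzh : segHeight a b z = segPos a b x := by linarith
  have hflat : ∀ u, segPos a b u ≠ segPos a b x → segPos a b u ≠ segPos a b z →
      segHeight a b u = 0 := by
    intro u h1 h2
    have := hX.three_hairs_le hL hlen hsne h1 h2
    rw [hC.dist_ends] at this
    linarith [nn u]
  have hx'flat := hflat x' (by linarith) (by linarith)
  have hxle : segPos a b x ≤ π / 4 := by linarith [nn x]
  set α := segPos a b x / 2 with hα
  obtain ⟨u, hu⟩ := hC.rel.exists_rel (-(3 * π / 4) - α)
  have hub := (hC.rel.dist_far hu hC.right (by linarith) (by linarith)).1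
  have hux := (hC.rel.dist_near hu hx (by linarith) (by linarith)).1
  have hux' := (hC.rel.dist_near hu hx' (by linarith) (by linarith)).1
  rw [hC.dist_right_eq] at hub
  have hule := neg_le_segPos a b u
  rw [hC.dist_ends] at hule
  rcases le_or_gt (segPos a b u) 0 with hu0 | hu0
  · have hh := hflat u (by linarith) (by linarith)
    have hd' := h4.dist_le a b u x'
    rcases abs_cases (segPos a b u - segPos a b x') with h | h <;> linarith
  by_cases h1 : segPos a b u = segPos a b x
  · have := hX.branched_hair_le hL hlen hsne h1
    rw [hC.dist_ends] at this
    linarith [nn u]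
  by_cases h2 : segPos a b u = segPos a b z
  · have := hX.two_hairs_le hL hlen (a := a) (b := b) (x := x) (z := u) (Ne.symm h1)
    rw [hC.dist_ends] at this
    linarith
  have hh := hflat u h1 h2
  have hd' := h4.dist_eq_of_lt (a := a) (b := b) (u := x') (v := u) (by linarith)
  rw [dist_comm] at hd'
  have hd'' := h4.dist_le a b u x
  rcases abs_cases (segPos a b u - segPos a b x) with h | h <;> linarith

/-- A hair of length `π / 4` is attached at the midpoint. -/
theorem CircleConfiguration.exists_apex [CompactSpace X]
    (hC : CircleConfiguration Q a b m) (hX : IsRTree X)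
    (hlen : treeLength X ≤ ENNReal.ofReal (5 * π / 4)) :
    ∃ z, segPos a b z = 0 ∧ π / 4 ≤ segHeight a b z := by
  have hpi := Real.pi_pos
  have h4 := hX.fourPoint
  obtain ⟨x, hx, hx0, hxh⟩ := hC.exists_rel_zero_right h4
  obtain ⟨x', hx', hx'0, hx'h⟩ := hC.neg.exists_rel_zero_right h4
  rw [segPos_swap] at hx'0 hx'h
  rw [segHeight_swap] at hx'h
  simp only [neg_zero] at hx'
  rcases hx0.eq_or_lt with hx0 | hx0
  · exact ⟨x, hx0.symm, by linarith⟩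
  rcases hx'0.eq_or_lt with hx'0 | hx'0
  · exact ⟨x', by linarith, by linarith⟩
  obtain ⟨z, hz⟩ := hC.rel.exists_rel (-π)
  have hz' : Q π z := by
    have := (hC.rel.add_period _ _).2 hz
    rwa [show -π + 2 * π = π by ring] at this
  have h1 := hC.segPos_nonpos_of_rel_pi hX hlen hx hx0 hxh hx' (by linarith) hx'h hz'
  have h2 := hC.neg.segPos_nonpos_of_rel_pi hX hlen (x := x') (x' := x) (z := z) (by simpa using hx')
    (by rw [segPos_swap]; exact hx'0) (by rw [segPos_swap, segHeight_swap]; exact hx'h)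
    (by simpa using hx) (by rw [segPos_swap]; linarith)
    (by rw [segPos_swap, segHeight_swap]; linarith) hz
  rw [segPos_swap] at h2
  have hz0 : segPos a b z = 0 := by linarith
  refine ⟨z, hz0, ?_⟩
  have hzx := (hC.rel.dist_near hx hz' (by linarith) (by linarith)).1
  rw [dist_comm, h4.dist_eq_of_lt (a := a) (b := b) (by linarith)] at hzx
  linarith

end CircleRelation

section Tripod

variable {X : Type*} [MetricSpace X]

theorem dist_tripod (p q : TripodE) :
    dist p q = |p.1 0 - q.1 0| + |p.1 1 - q.1 1| + |p.1 2 - q.1 2| := by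
  rw [Subtype.dist_eq, PiLp.dist_eq_of_L1, Fin.sum_univ_three]
  simp only [Real.dist_eq]

/-- Coordinates, in the model tripod, of a point of a tree with respect to a segment and a hair
attached at the midpoint. -/
def tripodMap (a b u : X) : PiLp 1 fun _ : Fin 3 => ℝ :=
  (WithLp.equiv 1 (∀ _ : Fin 3, ℝ)).symm
    ![max (segPos a b u) 0, max (-segPos a b u) 0, segHeight a b u]

theorem IsRTree.eq_union_of_length_le [CompactSpace X] (hX : IsRTree X) {L : ℝ} (hL : 0 ≤ L)
    (hlen : treeLength X ≤ ENNReal.ofReal L) {T : Set X} (hT : IsClosed T) (hne : T.Nonempty)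
    (h : LengthGE T L) (u : X) : u ∈ T := by
  have := h.add_le hX hL hlen hT.isCompact hne (u := u) (δ := infDist u T)
    fun t ht => infDist_le_dist_of_mem ht
  exact (hT.mem_iff_infDist_zero hne).2 (le_antisymm (by linarith) infDist_nonneg)

/-- A tree of length at most `5 * π / 4` containing a segment of length `π` and a hair of length
`π / 4` attached at its midpoint is the tripod. -/
theorem IsRTree.nonempty_isometryEquiv_tripod [CompactSpace X] (hX : IsRTree X)
    (hlen : treeLength X ≤ ENNReal.ofReal (5 * π / 4)) {a b z : X} (hab : dist a b = π)
    (hz : segPos a b z = 0) (hzh : π / 4 ≤ segHeight a b z) : Nonempty (X ≃ᵢ TripodE) := by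
  have hpi := Real.pi_pos
  have hL : (0 : ℝ) ≤ 5 * π / 4 := by positivity
  have h4 := hX.fourPoint
  obtain ⟨g, hg, -, hgz, hv, hlen'⟩ := hX.lengthGE_hair a b z
  have hle := hlen'.le hL hlen
  rw [hab] at hle hlen'
  have hzh : segHeight a b z = π / 4 := by linarith
  rw [hzh] at hgz
  simp only [hz, hzh] at hv
  have hmem : ∀ u, segHeight a b u = 0 ∨ segPos a b u = 0 ∧ dist g u = segHeight a b u ∧
      dist u z = π / 4 - segHeight a b u := by
    intro u
    have := hX.eq_union_of_length_le hL hlen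
      ((isClosed_metricInterval _ _).union (isClosed_metricInterval _ _)) ⟨g, Or.inl hg⟩
      (by convert hlen' using 1; rw [hzh]; ring) u
    exact this.imp segHeight_eq_zero.2 (hv u)
  have hzero : ∀ u v, segHeight a b u = 0 →
      dist u v = |segPos a b u - segPos a b v| + |segHeight a b u - segHeight a b v| := by
    intro u v hu
    have nn := segHeight_nonneg a b v
    rw [hu, zero_sub, abs_neg, abs_of_nonneg nn]
    rcases eq_or_ne (segPos a b u) (segPos a b v) with h | h
    · have h1 := h4.dist_le a b u v
      have h2 := segHeight_le_add a b v u
      rw [h, sub_self, abs_zero] at h1 ⊢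
      rw [dist_comm v u] at h2
      linarith
    · rw [h4.dist_eq_of_ne h]
      linarith
  have hdist : ∀ u v,
      dist u v = |segPos a b u - segPos a b v| + |segHeight a b u - segHeight a b v| := by
    intro u v
    rcases hmem u with hu | ⟨hu, hgu, huz⟩
    · exact hzero u v hu
    rcases hmem v with hv | ⟨hv, hgv, hvz⟩
    · rw [dist_comm, hzero v u hv, abs_sub_comm, abs_sub_comm (segHeight a b v)]
    rw [hu, hv, sub_self, abs_zero, zero_add]
    refine le_antisymm ?_ (abs_le.2 ⟨?_, ?_⟩)
    · have h := h4 g z u v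
      rw [hgu, hgv, hgz, dist_comm z u, dist_comm z v, huz, hvz] at h
      rcases le_max_iff.1 h with h | h
      · have := le_abs_self (segHeight a b u - segHeight a b v)
        linarith
      · have := neg_abs_le (segHeight a b u - segHeight a b v)
        linarith
    · have := segHeight_le_add a b v u
      rw [dist_comm v u] at this
      linarith
    · have := segHeight_le_add a b u v
      linarith
  have hmap : ∀ u, tripodMap a b u ∈ TripodSet := by
    intro u
    have h1 := segPos_le a b u
    have h2 := neg_le_segPos a b u
    rw [hab] at h1 h2
    rcases hmem u with hu | ⟨hu, hgu, huz⟩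
    · rcases le_total 0 (segPos a b u) with hs | hs
      · refine ⟨0, segPos a b u, hs, by simpa [tripodLeg] using h1, ?_⟩
        rw [tripodMap]
        congr 1
        ext j
        fin_cases j <;> simp [hu, hs]
      · refine ⟨1, -segPos a b u, by linarith, by simp [tripodLeg]; linarith, ?_⟩
        rw [tripodMap]
        congr 1
        ext j
        fin_cases j <;> simp [hu, hs]
    · refine ⟨2, segHeight a b u, segHeight_nonneg _ _ _, ?_, ?_⟩
      · have := dist_nonneg (x := u) (y := z)
        simp [tripodLeg]
        linarith
      rw [tripodMap]
      congr 1
      ext j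
      fin_cases j <;> simp [hu]
  let f : X → TripodE := fun u => ⟨tripodMap a b u, hmap u⟩
  have hf : Isometry f := by
    refine Isometry.of_dist_eq fun u v => ?_
    rw [dist_tripod, hdist]
    change |max (segPos a b u) 0 - max (segPos a b v) 0|
      + |max (-segPos a b u) 0 - max (-segPos a b v) 0|
      + |segHeight a b u - segHeight a b v| = _
    congr 1
    grind
  have hex : ∀ s, |s| ≤ π / 2 → ∃ u, segPos a b u = s ∧ segHeight a b u = 0 := by
    intro s hs
    rw [abs_le] at hs
    obtain ⟨u, h1, h2⟩ := hX.exists_dist_eq a b (t := π / 2 + s) (by linarith) (by linarith)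
    refine ⟨u, ?_, ?_⟩
    · rw [segPos, h1, h2, hab]
      ring
    · rw [segHeight, h1, h2, hab]
      ring
  have hsurj : Function.Surjective f := by
    rintro ⟨p, i, t, ht0, ht, rfl⟩
    have key : ∀ u, ![max (segPos a b u) 0, max (-segPos a b u) 0, segHeight a b u] =
        (fun j => if j = i then t else 0) → ∃ u, f u = ⟨_, i, t, ht0, ht, rfl⟩ :=
      fun u hu => ⟨u, Subtype.ext (congrArg (WithLp.equiv 1 (∀ _ : Fin 3, ℝ)).symm hu)⟩
    fin_cases i
    · obtain ⟨u, h1, h2⟩ := hex t (by rw [abs_of_nonneg ht0]; simpa [tripodLeg] using ht)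
      refine key u (funext fun j => ?_)
      fin_cases j <;> simp [h1, h2, ht0]
    · obtain ⟨u, h1, h2⟩ := hex (-t) (by rw [abs_neg, abs_of_nonneg ht0]; simpa [tripodLeg] using ht)
      refine key u (funext fun j => ?_)
      fin_cases j <;> simp [h1, h2, ht0]
    · simp [tripodLeg] at ht
      obtain ⟨u, h1, h2⟩ := hX.exists_dist_eq g z ht0 (by linarith)
      obtain ⟨h3, h4, h5⟩ := hv u (by change _ + _ = _; rw [h1, h2]; ring)
      refine key u (funext fun j => ?_)
      fin_cases j <;> simp [h3, ← h4, h1]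
  exact ⟨IsometryEquiv.mk (Equiv.ofBijective f ⟨hf.injective, hsurj⟩) hf⟩

end Tripod

section Main

theorem norm_coe_pi : ‖((π : ℝ) : AddCircle (2 * π))‖ = π := by
  rw [norm_coe_circle (by rw [abs_of_pos Real.pi_pos]), abs_of_pos Real.pi_pos]

theorem exists_coe_eq_abs_eq_norm (y : AddCircle (2 * π)) :
    ∃ t : ℝ, (t : AddCircle (2 * π)) = y ∧ |t| = ‖y‖ := by
  induction y using QuotientAddGroup.induction_on with
  | H t =>
    refine ⟨t - round ((2 * π)⁻¹ * t) * (2 * π), ?_, (AddCircle.norm_eq (2 * π)).symm⟩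
    rw [AddCircle.coe_sub, sub_eq_self, AddCircle.coe_eq_zero_iff]
    exact ⟨round ((2 * π)⁻¹ * t), by simp⟩

variable {X : Type*} [MetricSpace X]

theorem circleRelation_of_isCorrespondence {R : Set (X × IntrinsicCircle)}
    (hR : IsCorrespondence R) (hc : IsClosed R)
    (hdis : ∀ p ∈ R, ∀ q ∈ R, |dist p.1 q.1 - dist p.2 q.2| ≤ π / 2) (c : IntrinsicCircle) :
    CircleRelation fun θ u => (u, c + ((θ : ℝ) : IntrinsicCircle)) ∈ R where
  exists_rel θ := hR.2 _
  isClosed := by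
    refine hc.preimage (f := fun p : ℝ × X => (p.2, c + ((p.1 : ℝ) : IntrinsicCircle))) ?_
    have : Continuous fun t : ℝ => (t : IntrinsicCircle) := AddCircle.continuous_mk' _
    fun_prop
  add_period θ u := by rw [AddCircle.coe_add_period]
  abs_sub_le θ θ' u u' h h' := by
    have := hdis _ h _ h'
    rwa [dist_add_left, dist_eq_norm, ← AddCircle.coe_sub] at this

/-- A closed correspondence of distortion at most `π / 2` yields a point related to two points of
the circle at distance `π / 2`, whose antipodes are related to the ends of a segment centred at
that point. -/
theorem exists_antipodal_of_isCorrespondence [CompactSpace X] (hX : IsRTree X)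
    {R : Set (X × IntrinsicCircle)} (hR : IsCorrespondence R) (hc : IsClosed R)
    (hdis : ∀ p ∈ R, ∀ q ∈ R, |dist p.1 q.1 - dist p.2 q.2| ≤ π / 2) :
    ∃ (a b m : X) (y : IntrinsicCircle), (m, y) ∈ R ∧ (a, y + (π : ℝ)) ∈ R ∧
      (m, y + (π / 2 : ℝ)) ∈ R ∧ (b, y + (π / 2 : ℝ) + (π : ℝ)) ∈ R ∧
      dist a m = π / 2 ∧ dist m b = π / 2 ∧ dist a b = π := by
  have : Nonempty X := ⟨(hR.2 0).choose⟩
  have hclosed : IsClosed {p : X × X | ∃ y, (p.1, y) ∈ R ∧ (p.2, y + (π : ℝ)) ∈ R} := by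
    have h1 : IsClosed {w : (X × X) × IntrinsicCircle |
        (w.1.1, w.2) ∈ R ∧ (w.1.2, w.2 + (π : ℝ)) ∈ R} :=
      (hc.preimage (f := fun w : (X × X) × IntrinsicCircle => (w.1.1, w.2)) (by fun_prop)).inter
        (hc.preimage (f := fun w : (X × X) × IntrinsicCircle => (w.1.2, w.2 + (π : ℝ)))
          (by fun_prop))
    convert (h1.isCompact.image (continuous_fst (X := X × X) (Y := IntrinsicCircle))).isClosed
      using 1
    ext p
    simp
  obtain ⟨m, q, q', ⟨y, hmy, hqy⟩, ⟨y', hmy', hqy'⟩, hd⟩ := exists_between_of_isClosed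
    (r := fun p q => ∃ y, (p, y) ∈ R ∧ (q, y + (π : ℝ)) ∈ R) hX.fourPoint
    (fun x y t => hX.exists_dist_eq x y) hclosed fun x => by
      obtain ⟨y, hy⟩ := hR.1 x
      obtain ⟨q, hq⟩ := hR.2 (y + (π : ℝ))
      exact ⟨q, y, hy, hq⟩
  have hd1 := abs_le.1 (hdis _ hmy _ hqy)
  have hd2 := abs_le.1 (hdis _ hmy' _ hqy')
  have hd3 := abs_le.1 (hdis _ hqy _ hqy')
  have hd4 := abs_le.1 (hdis _ hmy _ hmy')
  simp only [dist_self_add_right, norm_coe_pi, dist_add_right, dist_self] at hd1 hd2 hd3 hd4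
  rw [dist_comm q m] at hd
  have h1 : dist m q = π / 2 := by linarith
  have h2 : dist m q' = π / 2 := by linarith
  have h3 : dist q q' = π := by linarith
  have h4 : ‖y' - y‖ = π / 2 := by rw [← dist_eq_norm, dist_comm]; linarith
  obtain ⟨τ, hτ, hτ'⟩ := exists_coe_eq_abs_eq_norm (y' - y)
  rw [h4] at hτ'
  rcases eq_or_eq_neg_of_abs_eq hτ' with rfl | rfl
  · obtain rfl : y' = y + (π / 2 : ℝ) := by rw [hτ, add_sub_cancel]
    exact ⟨q, q', m, y, hmy, hqy, hmy', hqy', by rw [dist_comm, h1], h2, h3⟩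
  · obtain rfl : y = y' + (π / 2 : ℝ) := by
      rw [AddCircle.coe_neg] at hτ
      rw [← neg_neg ((π / 2 : ℝ) : IntrinsicCircle), hτ]
      abel
    exact ⟨q', q, m, y', hmy', hqy', hmy, hqy, by rw [dist_comm, h2], h1, by rw [dist_comm, h3]⟩

theorem exists_circleConfiguration [CompactSpace X] (hX : IsRTree X)
    {R : Set (X × IntrinsicCircle)} (hR : IsCorrespondence R) (hc : IsClosed R)
    (hdis : ∀ p ∈ R, ∀ q ∈ R, |dist p.1 q.1 - dist p.2 q.2| ≤ π / 2) :
    ∃ (Q : ℝ → X → Prop) (a b m : X), CircleConfiguration Q a b m := by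
  obtain ⟨a, b, m, y, hm, ha, hm', hb, h1, h2, h3⟩ :=
    exists_antipodal_of_isCorrespondence hX hR hc hdis
  have hbase : ∀ s t : ℝ, s - 3 * π / 4 = t →
      y - ((3 * π / 4 : ℝ) : IntrinsicCircle) + (s : ℝ) = y + (t : ℝ) := by
    rintro s t rfl
    rw [AddCircle.coe_sub]
    abel
  have hbase' : ∀ s t : ℝ, s - 3 * π / 4 + 2 * π = t →
      y - ((3 * π / 4 : ℝ) : IntrinsicCircle) + (s : ℝ) = y + (t : ℝ) := by
    rintro s t rfl
    rw [AddCircle.coe_add_period]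
    exact hbase _ _ rfl
  rw [add_assoc, ← AddCircle.coe_add] at hb
  refine ⟨_, a, b, m, circleRelation_of_isCorrespondence hR hc hdis
    (y - ((3 * π / 4 : ℝ) : IntrinsicCircle)), ?_, ?_, ?_, ?_, h1, h2, h3⟩
  · rwa [hbase' _ π (by ring)]
  · rwa [hbase' _ (π / 2 + π) (by ring)]
  · rwa [hbase _ 0 (by ring), AddCircle.coe_zero, add_zero]
  · rwa [hbase' _ (π / 2) (by ring)]

end Main

/-- **Proposition 4.4 (uniqueness of `E`).** Any complete `ℝ`-tree of length at most
`5π/4` at Gromov–Hausdorff distance exactly `π/4` from `S¹` is isometric to the tripod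
`E` with legs of lengths `π/2, π/2, π/4`. -/
theorem rtree_ghDist_circle_isometric_tripod {X : Type*} [MetricSpace X] [CompleteSpace X]
    (hX : IsRTree X) (hlen : treeLength X ≤ ENNReal.ofReal (5 * π / 4))
    (hGH : ghDist X IntrinsicCircle = ENNReal.ofReal (π / 4)) :
    Nonempty (X ≃ᵢ TripodE) := by
  have := hX.compactSpace hlen
  obtain ⟨R, hR, hc, hdis⟩ := exists_isClosed_isCorrespondence (by positivity) hGH
  rw [show 2 * (π / 4) = π / 2 by ring] at hdis
  obtain ⟨Q, a, b, m, hC⟩ := exists_circleConfiguration hX hR hc hdis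
  obtain ⟨z, hz, hzh⟩ := hC.exists_apex hX hlen
  exact hX.nonempty_isometryEquiv_tripod hlen hC.dist_ends hz hzh

end
end

section
/- Every complete ℝ-tree of finite length is compact. In particular, a complete ℝ-tree of length at most 5π/4 is compact. -/
open Real Set Metric
open scoped ENNReal unitInterval

noncomputable section

/-- A point of an `ℝ`-tree lies on arcs of every length up to its distance from another point. -/
theorem IsRTree.exists_arc_subset_closedBall {X : Type*} [MetricSpace X] (hX : IsRTree X)
    {x y : X} {r : ℝ} (hr : 0 < r) (hxy : r ≤ dist x y) :
    ∃ A : Set X, (∃ a b : X, a ≠ b ∧ IsArcBetween a b A) ∧ A.Nonempty ∧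
      A ⊆ closedBall x r ∧ ENNReal.ofReal r ≤ ediam A := by
  have hne : x ≠ y := dist_pos.mp (hr.trans_le hxy)
  obtain ⟨⟨B, hB, -⟩, hgeod⟩ := hX x y hne
  obtain ⟨γ, hγ0, -, -, hγ⟩ := hgeod B hB
  have hmem : ∀ t : unitInterval, r * (t : ℝ) ∈ Icc 0 (dist x y) := fun t =>
    ⟨mul_nonneg hr.le t.2.1, (mul_le_of_le_one_right hr.le t.2.2).trans hxy⟩
  let δ : unitInterval → X := fun t => γ (r * t)
  have hδ : ∀ s t, dist (δ s) (δ t) = r * dist s t := fun s t => by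
    rw [hγ _ (hmem s) _ (hmem t), ← mul_sub, abs_mul, abs_of_pos hr, Subtype.dist_eq,
      Real.dist_eq]
  have hinj : Function.Injective δ := fun s t hst => by
    have h := hδ s t
    rw [hst, dist_self, eq_comm, mul_eq_zero] at h
    exact dist_eq_zero.mp (h.resolve_left hr.ne')
  have hcont : Continuous δ :=
    (LipschitzWith.of_dist_le_mul (K := ⟨r, hr.le⟩) fun s t => (hδ s t).le).continuous
  have hδ0 : δ 0 = x := by simp [δ, hγ0]
  refine ⟨range δ, ⟨δ 0, δ 1, hinj.ne zero_ne_one, ⟨δ, hcont⟩, hinj, rfl, rfl, rfl⟩,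
    range_nonempty δ, ?_, ?_⟩
  · rintro _ ⟨t, rfl⟩
    rw [mem_closedBall, ← hδ0, hδ, Subtype.dist_eq, Real.dist_eq]
    simpa [abs_of_nonneg t.2.1] using mul_le_of_le_one_right hr.le t.2.2
  · have h : dist (δ 0) (δ 1) = r := by simp [hδ, Subtype.dist_eq, Real.dist_eq]
    rw [← h, ← edist_dist]
    exact edist_le_ediam_of_mem (mem_range_self 0) (mem_range_self 1)

/-- Infinitely many pairwise disjoint arcs of diameter bounded below force infinite length. -/
theorem treeLength_eq_top_of_pairwise_disjoint {X : Type*} [MetricSpace X] {A : ℕ → Set X}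
    (harc : ∀ n, ∃ a b : X, a ≠ b ∧ IsArcBetween a b (A n)) (hne : ∀ n, (A n).Nonempty)
    (hdisj : Pairwise fun m n => Disjoint (A m) (A n)) {c : ℝ≥0∞} (hc : c ≠ 0)
    (hdiam : ∀ n, c ≤ ediam (A n)) : treeLength X = ⊤ := by
  classical
  have hinj : Function.Injective A := fun m n hmn => by
    by_contra h
    have hd : Disjoint (A m) (A n) := hdisj h
    rw [hmn, disjoint_self] at hd
    exact (hne n).ne_empty hd
  have hbound : ∀ N : ℕ, N * c ≤ treeLength X := fun N => by
    have hS : (∀ B ∈ (Finset.range N).image A, ∃ a b : X, a ≠ b ∧ IsArcBetween a b B) ∧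
        (((Finset.range N).image A : Finset (Set X)) : Set (Set X)).Pairwise Disjoint := by
      refine ⟨fun B hB => ?_, fun B hB C hC hBC => ?_⟩
      · obtain ⟨n, -, rfl⟩ := Finset.mem_image.mp hB
        exact harc n
      · obtain ⟨m, -, rfl⟩ := Finset.mem_image.mp hB
        obtain ⟨n, -, rfl⟩ := Finset.mem_image.mp hC
        exact hdisj fun h => hBC (congrArg A h)
    calc (N : ℝ≥0∞) * c = ∑ _n ∈ Finset.range N, c := by simp
      _ ≤ ∑ n ∈ Finset.range N, ediam (A n) := Finset.sum_le_sum fun n _ => hdiam n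
      _ = ∑ B ∈ (Finset.range N).image A, ediam B :=
          (Finset.sum_image hinj.injOn).symm
      _ ≤ treeLength X := le_iSup₂_of_le _ hS le_rfl
  by_contra h
  obtain ⟨N, hN⟩ := ENNReal.exists_nat_mul_gt hc h
  exact (hbound N).not_gt hN

/-- A space that is not totally bounded contains a uniformly separated sequence. -/
theorem exists_separated_seq_of_not_totallyBounded {X : Type*} [PseudoMetricSpace X]
    (h : ¬TotallyBounded (univ : Set X)) :
    ∃ ε > 0, ∃ f : ℕ → X, Pairwise fun m n => ε ≤ dist (f m) (f n) := by
  simp only [Metric.totallyBounded_iff, not_forall] at h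
  obtain ⟨ε, hε, h⟩ := h
  have : Std.Symm fun x y : X => ε ≤ dist x y := ⟨fun x y hxy => by rwa [dist_comm]⟩
  obtain ⟨f, -, hf⟩ := exists_seq_of_forall_finset_exists' (fun _ : X => True)
    (fun x y => ε ≤ dist x y) fun s _ => by
      by_contra! hs
      refine h ⟨s, s.finite_toSet, fun y _ => ?_⟩
      obtain ⟨x, hx, hxy⟩ := hs y trivial
      exact mem_iUnion₂.mpr ⟨x, hx, by rwa [mem_ball']⟩
  exact ⟨ε, hε, f, hf⟩

/-- **Claim 4.7.** Every complete `ℝ`-tree of finite length is compact (in particular,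
a complete `ℝ`-tree of length at most `5π/4` is compact). -/
theorem rtree_compact_of_finite_length {X : Type*} [MetricSpace X] [CompleteSpace X]
    (hX : IsRTree X) (hlen : treeLength X < ⊤) :
    CompactSpace X := by
  rw [← isCompact_univ_iff, isCompact_iff_totallyBounded_isComplete]
  refine ⟨?_, isClosed_univ.isComplete⟩
  by_contra h
  obtain ⟨ε, hε, f, hf⟩ := exists_separated_seq_of_not_totallyBounded h
  have hsep : ∀ n, ε / 3 ≤ dist (f n) (f (n + 1)) := fun n =>
    (by linarith : ε / 3 ≤ ε).trans (hf n.succ_ne_self.symm)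
  choose A harc hne hball hdiam using fun n =>
    hX.exists_arc_subset_closedBall (by positivity : 0 < ε / 3) (hsep n)
  have hdisj : Pairwise fun m n => Disjoint (A m) (A n) := fun m n hmn =>
    (closedBall_disjoint_closedBall (by linarith [hf hmn])).mono (hball m) (hball n)
  exact hlen.ne (treeLength_eq_top_of_pairwise_disjoint harc hne hdisj
    (ENNReal.ofReal_pos.mpr (by positivity)).ne' hdiam)

end
end
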